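/- Let V be an n-graded vector space over a field 𝕂 of characteristic 0 and let A(V) = α(M(V)) be the image of the multigraded alternator, with bracket [K₁,K₂]^∧ = i(K₁)K₂ − (−1)^{k₁k₂+⟨κ₁,κ₂⟩} i(K₂)K₁. Then (A(V), [·,·]^∧) is an (n+1)-graded Lie algebra: [A^{(k₁,κ₁)}(V), A^{(k₂,κ₂)}(V)] ⊆ A^{(k₁+k₂,κ₁+κ₂)}(V), the bracket is (n+1)-graded anticommutative, and it satisfies the (n+1)-graded Jacobi identity [K₁,[K₂,K₃]^∧]^∧ = [[K₁,K₂]^∧,K₃]^∧ + (−1)^{k₁k₂+⟨κ₁,κ₂⟩}[K₂,[K₁,K₃]^∧]^∧ for Kᵢ ∈ A^{(kᵢ,κᵢ)}(V). -/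

import Mathlib

namespace NR

open Finset

/-- The sign `(-1)^z` for an integer `z`. -/
def sgn (z : ℤ) : ℤ := (-1) ^ z.natAbs

/-- The inner product `⟨x,y⟩ = ∑ i, xⁱ yⁱ` of multidegrees `x, y ∈ ℤⁿ`. -/
def pairZ (n : ℕ) (x y : Fin n → ℤ) : ℤ := ∑ i, x i * y i

/-- The inner product of `(n+1)`-degrees in `ℤ × ℤⁿ`. -/
def prE (n : ℕ) (g h : ℤ × (Fin n → ℤ)) : ℤ := g.1 * h.1 + pairZ n g.2 h.2

/-- Shift a sequence: `shiftSeq f i = (f i, f (i+1), …)`. -/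
def shiftSeq {β : Type*} (f : ℕ → β) (i : ℕ) : ℕ → β := fun m => f (m + i)

/-- Insert the value `c` at slot `i` of the sequence `f`, where `c` replaces
`a` consecutive entries of `f` (the entries `f i, …, f (i+a-1)`). -/
def insSeq {β : Type*} (a i : ℕ) (c : β) (f : ℕ → β) : ℕ → β :=
  fun l => if l < i then f l else if l = i then c else f (l + a - 1)

/-- Permute the first `a` entries of a sequence by `σ`. -/
def permSeq {β : Type*} (a : ℕ) (σ : Equiv.Perm (Fin a)) (f : ℕ → β) : ℕ → β :=
  fun l => if h : l < a then f ((σ ⟨l, h⟩ : Fin a) : ℕ) else f l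

/-- The multigraded sign `sign(σ, x)` of a permutation `σ` of `a` symbols with respect to
the multidegrees `x 0, …, x (a-1)`; it is the ordinary sign times the Koszul sign
collected over the inversions of `σ`. -/
def gsign {G : Type*} (pr : G → G → ℤ) (a : ℕ) (σ : Equiv.Perm (Fin a)) (x : ℕ → G) : ℤ :=
  ((Equiv.Perm.sign σ : ℤˣ) : ℤ) *
    (-1) ^ (∑ p ∈ Finset.univ.filter
        (fun p : Fin a × Fin a => p.1 < p.2 ∧ σ p.2 < σ p.1),
        pr (x ((σ p.1 : Fin a) : ℕ)) (x ((σ p.2 : Fin a) : ℕ))).natAbs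

section Ops

variable {G U : Type*} [AddCommGroup G] [AddCommGroup U]

/-- The operation `j(K₁)K₂` of the multigraded Nijenhuis–Richardson calculus.
`K₁` represents an element of `M^{(k₁,κ₁)}(U)` of arity `a₁ = k₁+1` and `K₂` one of
`M^{(k₂,κ₂)}(U)` of arity `a₂ = k₂+1`; an element of arity `a` is coded as a function
taking the sequence of multidegrees of the (homogeneous) arguments and the sequence of
arguments, and depending only on the first `a` of them. -/
def jop (pr : G → G → ℤ) (a₁ : ℕ) (κ₁ : G) (a₂ : ℕ) (κ₂ : G)
    (K₁ K₂ : (ℕ → G) → (ℕ → U) → U) : (ℕ → G) → (ℕ → U) → U :=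
  fun x X => ∑ i ∈ Finset.range a₂,
    sgn (((a₁ : ℤ) - 1) * (i : ℤ) + pr κ₁ (κ₂ + ∑ l ∈ Finset.range i, x l)) •
      K₂ (insSeq a₁ i ((∑ m ∈ Finset.range a₁, x (m + i)) + κ₁) x)
         (insSeq a₁ i (K₁ (shiftSeq x i) (shiftSeq X i)) X)

/-- The multigraded bracket `[K₁,K₂]^Δ = j(K₁)K₂ - (-1)^{k₁k₂+⟨κ₁,κ₂⟩} j(K₂)K₁`. -/
def brD (pr : G → G → ℤ) (a₁ : ℕ) (κ₁ : G) (a₂ : ℕ) (κ₂ : G)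
    (K₁ K₂ : (ℕ → G) → (ℕ → U) → U) : (ℕ → G) → (ℕ → U) → U :=
  fun x X => jop pr a₁ κ₁ a₂ κ₂ K₁ K₂ x X
    - sgn (((a₁ : ℤ) - 1) * ((a₂ : ℤ) - 1) + pr κ₁ κ₂) • jop pr a₂ κ₂ a₁ κ₁ K₂ K₁ x X

end Ops

/-- `K` represents a (`a`-linear) element of `M(U)`: it does not depend on the degree
sequence, depends only on the first `a` arguments, and is `𝕂`-multilinear in them. -/
def IsML (𝕂 : Type*) [Field 𝕂] {G U U' : Type*} [AddCommGroup U] [Module 𝕂 U]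
    [AddCommGroup U'] [Module 𝕂 U'] (a : ℕ) (K : (ℕ → G) → (ℕ → U) → U') : Prop :=
  (∀ x x' X, K x X = K x' X) ∧
  (∀ x X X', (∀ i, i < a → X i = X' i) → K x X = K x X') ∧
  (∀ x X i, i < a →
    (∀ u v : U, K x (Function.update X i (u + v))
        = K x (Function.update X i u) + K x (Function.update X i v)) ∧
    (∀ (r : 𝕂) (u : U), K x (Function.update X i (r • u)) = r • K x (Function.update X i u)))

/-- `K ∈ M^{(a-1,κ)}(U)`: an `a`-linear map mapping `U^{x₀} × ⋯ × U^{x_{a-1}}` into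
`U^{x₀+⋯+x_{a-1}+κ}`. -/
def MDeg (𝕂 : Type*) [Field 𝕂] {G U : Type*} [AddCommGroup G] [AddCommGroup U] [Module 𝕂 U]
    (gr : G → Submodule 𝕂 U) (a : ℕ) (κ : G) (K : (ℕ → G) → (ℕ → U) → U) : Prop :=
  IsML 𝕂 a K ∧
  ∀ x X, (∀ i, X i ∈ gr (x i)) → K x X ∈ gr ((∑ i ∈ Finset.range a, x i) + κ)

/-- The multigraded alternator `α` on elements of arity `a`. -/
def alt (𝕂 : Type*) [Field 𝕂] {G U U' : Type*} [AddCommGroup U'] [Module 𝕂 U']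
    (pr : G → G → ℤ) (a : ℕ) (K : (ℕ → G) → (ℕ → U) → U') : (ℕ → G) → (ℕ → U) → U' :=
  fun x X => (a.factorial : 𝕂)⁻¹ •
    ∑ σ : Equiv.Perm (Fin a),
      ((gsign pr a σ x : ℤ) : 𝕂) • K (permSeq a σ x) (permSeq a σ X)

/-- The operation `i(K₁)K₂ = ((k₁+k₂+1)!/((k₁+1)!(k₂+1)!)) α(j(K₁)K₂)`. -/
def iop (𝕂 : Type*) [Field 𝕂] {G U : Type*} [AddCommGroup G] [AddCommGroup U] [Module 𝕂 U]
    (pr : G → G → ℤ) (a₁ : ℕ) (κ₁ : G) (a₂ : ℕ) (κ₂ : G)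
    (K₁ K₂ : (ℕ → G) → (ℕ → U) → U) : (ℕ → G) → (ℕ → U) → U :=
  fun x X =>
    (((a₁ + a₂ - 1).factorial : 𝕂) / ((a₁.factorial : 𝕂) * (a₂.factorial : 𝕂))) •
      alt 𝕂 pr (a₁ + a₂ - 1) (jop pr a₁ κ₁ a₂ κ₂ K₁ K₂) x X

/-- The multigraded Nijenhuis–Richardson bracket
`[K₁,K₂]^∧ = i(K₁)K₂ - (-1)^{k₁k₂+⟨κ₁,κ₂⟩} i(K₂)K₁`. -/
def brW (𝕂 : Type*) [Field 𝕂] {G U : Type*} [AddCommGroup G] [AddCommGroup U] [Module 𝕂 U]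
    (pr : G → G → ℤ) (a₁ : ℕ) (κ₁ : G) (a₂ : ℕ) (κ₂ : G)
    (K₁ K₂ : (ℕ → G) → (ℕ → U) → U) : (ℕ → G) → (ℕ → U) → U :=
  fun x X => iop 𝕂 pr a₁ κ₁ a₂ κ₂ K₁ K₂ x X
    - sgn (((a₁ : ℤ) - 1) * ((a₂ : ℤ) - 1) + pr κ₁ κ₂) • iop 𝕂 pr a₂ κ₂ a₁ κ₁ K₂ K₁ x X

/-- `K ∈ A^{(a-1,κ)}(U) = α(M^{(a-1,κ)}(U))`, i.e. `K ∈ M^{(a-1,κ)}(U)` and `K` is fixed by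
the multigraded alternator (on homogeneous arguments). -/
def ADeg (𝕂 : Type*) [Field 𝕂] {G U : Type*} [AddCommGroup G] [AddCommGroup U] [Module 𝕂 U]
    (pr : G → G → ℤ) (gr : G → Submodule 𝕂 U) (a : ℕ) (κ : G)
    (K : (ℕ → G) → (ℕ → U) → U) : Prop :=
  MDeg 𝕂 gr a κ K ∧
  ∀ x X, (∀ i, X i ∈ gr (x i)) → alt 𝕂 pr a K x X = K x X

/-- The bilinear map `P` coded as an element of arity `2`. -/
def KofBil {𝕂 : Type*} [Field 𝕂] {G U : Type*} [AddCommGroup U] [Module 𝕂 U]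
    (P : U →ₗ[𝕂] U →ₗ[𝕂] U) : (ℕ → G) → (ℕ → U) → U :=
  fun _ X => P (X 0) (X 1)



/-! ### Signs -/

lemma sgn_add (a b : ℤ) : sgn (a + b) = sgn a * sgn b := by
  unfold sgn
  rw [← pow_add]
  rcases Nat.even_or_odd (a + b).natAbs with h | h
  · have h' : Even (a.natAbs + b.natAbs) := by
      rw [Int.natAbs_even] at h
      rw [Nat.even_add, Int.natAbs_even, Int.natAbs_even]
      exact Int.even_add.mp h
    rw [h.neg_one_pow, h'.neg_one_pow]
  · have h' : Odd (a.natAbs + b.natAbs) := by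
      rw [Int.natAbs_odd, Int.odd_add] at h
      rw [Nat.odd_add, Int.natAbs_odd, Int.natAbs_even]
      exact h
    rw [h.neg_one_pow, h'.neg_one_pow]

lemma sgn_mul_self (a : ℤ) : sgn a * sgn a = 1 := by
  unfold sgn
  rw [← pow_add]
  exact Even.neg_one_pow ⟨_, rfl⟩

lemma sgn_two_mul (a : ℤ) : sgn (2 * a) = 1 := by
  rw [two_mul, sgn_add, sgn_mul_self]

lemma sgn_congr {a b : ℤ} (w : ℤ) (h : a = b + 2 * w) : sgn a = sgn b := by
  rw [h, sgn_add, sgn_two_mul, mul_one]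

lemma sgn_one : sgn 1 = -1 := by simp [sgn]

lemma sgn_zero : sgn 0 = 1 := by simp [sgn]

lemma neg_sgn (a : ℤ) : - sgn a = sgn (a + 1) := by
  rw [sgn_add, sgn_one]; ring

lemma pairZ_comm (n : ℕ) (x y : Fin n → ℤ) : pairZ n x y = pairZ n y x := by
  unfold pairZ
  exact Finset.sum_congr rfl fun i _ => mul_comm _ _

lemma pairZ_add_left (n : ℕ) (x y z : Fin n → ℤ) :
    pairZ n (x + y) z = pairZ n x z + pairZ n y z := by
  unfold pairZ
  rw [← Finset.sum_add_distrib]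
  exact Finset.sum_congr rfl fun i _ => by simp [add_mul]

lemma pairZ_add_right (n : ℕ) (x y z : Fin n → ℤ) :
    pairZ n x (y + z) = pairZ n x y + pairZ n x z := by
  rw [pairZ_comm, pairZ_add_left, pairZ_comm n y, pairZ_comm n z]

lemma pairZ_zero_left (n : ℕ) (z : Fin n → ℤ) : pairZ n 0 z = 0 := by
  simp [pairZ]

/-! ### The graded sign and adjacent transpositions -/

lemma gsign_mul_swap (n a : ℕ) (σ : Equiv.Perm (Fin a)) (k k' : Fin a)
    (hk : (k' : ℕ) = k + 1) (x : ℕ → (Fin n → ℤ)) :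
    gsign (pairZ n) a (σ * Equiv.swap k k') x
      = gsign (pairZ n) a σ x * (- sgn (pairZ n (x (σ k)) (x (σ k')))) := by
  classical
  have hne : k ≠ k' := by
    intro h; rw [← h] at hk; omega
  have hkk : k < k' := by rw [Fin.lt_def]; omega
  set s := Equiv.swap k k' with hs
  set c : Fin a × Fin a → ℤ := fun p => pairZ n (x (σ p.1)) (x (σ p.2)) with hc
  have key : ∃ w : ℤ,
      (∑ p ∈ Finset.univ.filter
        (fun p : Fin a × Fin a => p.1 < p.2 ∧ (σ * s) p.2 < (σ * s) p.1),
        pairZ n (x (((σ * s) p.1 : Fin a) : ℕ)) (x (((σ * s) p.2 : Fin a) : ℕ)))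
      = (∑ p ∈ Finset.univ.filter
        (fun p : Fin a × Fin a => p.1 < p.2 ∧ σ p.2 < σ p.1),
        pairZ n (x ((σ p.1 : Fin a) : ℕ)) (x ((σ p.2 : Fin a) : ℕ)))
        + pairZ n (x (σ k)) (x (σ k')) + 2 * w := by
    rw [Finset.sum_filter, Finset.sum_filter]
    rw [← Finset.add_sum_erase _ _ (Finset.mem_univ (k, k')),
      ← Finset.add_sum_erase _ (fun p : Fin a × Fin a =>
        if p.1 < p.2 ∧ σ p.2 < σ p.1 then
          pairZ n (x ((σ p.1 : Fin a) : ℕ)) (x ((σ p.2 : Fin a) : ℕ)) else 0)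
        (Finset.mem_univ (k, k'))]
    have hrest : ∑ p ∈ (Finset.univ : Finset (Fin a × Fin a)).erase (k, k'),
        (if p.1 < p.2 ∧ (σ * s) p.2 < (σ * s) p.1 then
          pairZ n (x (((σ * s) p.1 : Fin a) : ℕ)) (x (((σ * s) p.2 : Fin a) : ℕ)) else 0)
        = ∑ p ∈ (Finset.univ : Finset (Fin a × Fin a)).erase (k, k'),
        (if p.1 < p.2 ∧ σ p.2 < σ p.1 then
          pairZ n (x ((σ p.1 : Fin a) : ℕ)) (x ((σ p.2 : Fin a) : ℕ)) else 0) := by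
      have hlt : ∀ p q : Fin a, p < q → (p, q) ≠ (k, k') → s p < s q := by
        intro p q hpq hn
        rw [hs, Equiv.swap_apply_def, Equiv.swap_apply_def]
        simp only [Fin.ext_iff, Fin.lt_def, Prod.mk.injEq, ne_eq] at *
        split_ifs <;> omega
      have hsk : s k = k' := Equiv.swap_apply_left _ _
      have hsk' : s k' = k := Equiv.swap_apply_right _ _
      have hss : ∀ p, s (s p) = p := fun p => by
        rw [hs, ← Equiv.Perm.mul_apply, Equiv.swap_mul_self, Equiv.Perm.one_apply]
      rw [← Finset.sum_filter_of_ne (p := fun p : Fin a × Fin a => p.1 < p.2),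
        ← Finset.sum_filter_of_ne (p := fun p : Fin a × Fin a => p.1 < p.2)
          (s := (Finset.univ : Finset (Fin a × Fin a)).erase (k, k'))
          (f := fun p : Fin a × Fin a => if p.1 < p.2 ∧ σ p.2 < σ p.1 then
          pairZ n (x ((σ p.1 : Fin a) : ℕ)) (x ((σ p.2 : Fin a) : ℕ)) else 0)]
      · have hmem : ∀ p : Fin a × Fin a,
            p ∈ ((Finset.univ : Finset (Fin a × Fin a)).erase (k, k')).filter
              (fun p => p.1 < p.2) →
            (s p.1, s p.2) ∈ ((Finset.univ : Finset (Fin a × Fin a)).erase (k, k')).filter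
              (fun p => p.1 < p.2) := by
          rintro ⟨p, q⟩ h
          simp only [Finset.mem_filter, Finset.mem_erase, Finset.mem_univ, and_true] at h ⊢
          refine ⟨?_, hlt p q h.2 h.1⟩
          intro hh
          rw [Prod.mk.injEq] at hh
          have h1 : p = k' := by rw [← hss p, hh.1, hsk]
          have h2 : q = k := by rw [← hss q, hh.2, hsk']
          rw [h1, h2] at h
          exact absurd h.2 (not_lt.mpr hkk.le)
        refine Finset.sum_bij' (fun p _ => (s p.1, s p.2)) (fun p _ => (s p.1, s p.2))
          hmem hmem ?_ ?_ ?_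
        · rintro ⟨p, q⟩ _; simp [hss]
        · rintro ⟨p, q⟩ _; simp [hss]
        · rintro ⟨p, q⟩ h
          have h2 := hmem _ h
          simp only [Finset.mem_filter, Finset.mem_erase, Finset.mem_univ, and_true] at h h2
          simp [h.2, h2.2]
      · intro p _ h
        by_contra hh
        exact h (if_neg fun h' => hh h'.1)
      · intro p _ h
        by_contra hh
        exact h (if_neg fun h' => hh h'.1)
    rw [hrest]
    have e1 : (σ * s) k = σ k' := by rw [Equiv.Perm.mul_apply, hs, Equiv.swap_apply_left]
    have e2 : (σ * s) k' = σ k := by rw [Equiv.Perm.mul_apply, hs, Equiv.swap_apply_right]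
    simp only [e1, e2, hkk, true_and]
    have hσ : σ k ≠ σ k' := fun h => hne (σ.injective h)
    rcases lt_or_gt_of_ne hσ with h | h
    · rw [if_pos h, if_neg (not_lt.mpr h.le), pairZ_comm n (x (σ k'))]
      exact ⟨0, by ring⟩
    · rw [if_pos h, if_neg (not_lt.mpr h.le)]
      exact ⟨- pairZ n (x (σ k)) (x (σ k')), by ring⟩
  obtain ⟨w, hw⟩ := key
  have h1 := sgn_congr w hw
  rw [sgn_add] at h1
  unfold sgn at h1
  unfold gsign
  rw [h1, Equiv.Perm.sign_mul, hs, Equiv.Perm.sign_swap hne]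
  unfold sgn
  push_cast
  ring


/-! ### Adjacent transpositions acting on cochains -/

/-- Graded-alternating action of the adjacent transposition `(k, k+1)` on cochains. -/
def tsw {n : ℕ} {V : Type} [AddCommGroup V] (k : ℕ)
    (F : (ℕ → (Fin n → ℤ)) → (ℕ → V) → V) : (ℕ → (Fin n → ℤ)) → (ℕ → V) → V :=
  fun x X => (- sgn (pairZ n (x k) (x (k + 1)))) •
    F (fun l => x (Equiv.swap k (k + 1) l)) (fun l => X (Equiv.swap k (k + 1) l))

/-- Graded-alternating action of a permutation on cochains. -/
def pact {n : ℕ} {V : Type} [AddCommGroup V] (a : ℕ) (σ : Equiv.Perm (Fin a))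
    (F : (ℕ → (Fin n → ℤ)) → (ℕ → V) → V) : (ℕ → (Fin n → ℤ)) → (ℕ → V) → V :=
  fun x X => gsign (pairZ n) a σ x • F (permSeq a σ x) (permSeq a σ X)

lemma tsw_tsw {n : ℕ} {V : Type} [AddCommGroup V] (k : ℕ)
    (F : (ℕ → (Fin n → ℤ)) → (ℕ → V) → V) : tsw k (tsw k F) = F := by
  funext x X
  unfold tsw
  simp only [Equiv.swap_apply_left, Equiv.swap_apply_right, Equiv.swap_apply_self, smul_smul]
  rw [pairZ_comm n (x (k + 1))]
  rw [neg_mul_neg, sgn_mul_self, one_smul]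

lemma permSeq_mul_swap {β : Type*} (a : ℕ) (σ : Equiv.Perm (Fin a)) (k k' : Fin a)
    (hk : (k' : ℕ) = k + 1) (x : ℕ → β) :
    permSeq a (σ * Equiv.swap k k') x
      = fun l => permSeq a σ x (Equiv.swap (k : ℕ) (k + 1) l) := by
  funext l
  unfold permSeq
  have hk' := k'.2
  have hk0 := k.2
  by_cases h : l < a
  · rw [dif_pos h]
    have h2 : Equiv.swap (k : ℕ) (k + 1) l < a := by
      rw [Equiv.swap_apply_def]; split_ifs <;> omega
    rw [dif_pos h2, Equiv.Perm.mul_apply]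
    congr 3
    apply Fin.ext
    change _ = Equiv.swap (k : ℕ) (k + 1) l
    rw [Equiv.swap_apply_def, Equiv.swap_apply_def]
    simp only [Fin.ext_iff]
    split_ifs <;> simp_all
  · have h3 : Equiv.swap (k : ℕ) (k + 1) l = l := by
      rw [Equiv.swap_apply_def]; split_ifs <;> omega
    rw [dif_neg h, h3, dif_neg h]

lemma pact_mul_swap {n : ℕ} {V : Type} [AddCommGroup V] (a : ℕ) (σ : Equiv.Perm (Fin a))
    (k k' : Fin a) (hk : (k' : ℕ) = k + 1) (F : (ℕ → (Fin n → ℤ)) → (ℕ → V) → V) :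
    pact a (σ * Equiv.swap k k') F = pact a σ (tsw k F) := by
  funext x X
  unfold pact tsw
  rw [gsign_mul_swap n a σ k k' hk, permSeq_mul_swap a σ k k' hk, permSeq_mul_swap a σ k k' hk,
    smul_smul]
  have e : k' = ⟨k + 1, hk ▸ k'.2⟩ := Fin.ext hk
  have e1 : permSeq a σ x k = x (σ k) := by
    unfold permSeq; rw [dif_pos k.2]
  have e2 : permSeq a σ x (k + 1) = x (σ k') := by
    unfold permSeq; rw [dif_pos (hk ▸ k'.2)]; exact congrArg (fun j => x (σ j)) e.symm
  rw [e1, e2]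

lemma pact_one {n : ℕ} {V : Type} [AddCommGroup V] (a : ℕ)
    (F : (ℕ → (Fin n → ℤ)) → (ℕ → V) → V) : pact a 1 F = F := by
  funext x X
  have h : ∀ {β : Type} (f : ℕ → β), permSeq a 1 f = f := by
    intro β f; funext l; simp [permSeq]
  have hg : gsign (pairZ n) a 1 x = 1 := by
    unfold gsign
    rw [Finset.sum_eq_zero]
    · simp
    · intro p hp
      have hp' := (Finset.mem_filter.mp hp).2
      exact absurd hp'.1 (not_lt.mpr (le_of_lt hp'.2))
  unfold pact
  rw [hg, h, h, one_smul]

/-- The alternator as a linear map. -/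
def altL (𝕂 : Type) [Field 𝕂] (n : ℕ) (V : Type) [AddCommGroup V] [Module 𝕂 V] (a : ℕ) :
    ((ℕ → (Fin n → ℤ)) → (ℕ → V) → V) →ₗ[𝕂] ((ℕ → (Fin n → ℤ)) → (ℕ → V) → V) where
  toFun := alt 𝕂 (pairZ n) a
  map_add' F F' := by
    funext x X
    simp [alt, Finset.sum_add_distrib]
  map_smul' r F := by
    funext x X
    simp only [alt, Pi.smul_apply, RingHom.id_apply]
    simp_rw [smul_comm _ r, ← Finset.smul_sum]
    rw [smul_comm]

lemma altL_eq {𝕂 : Type} [Field 𝕂] {n : ℕ} {V : Type} [AddCommGroup V] [Module 𝕂 V] (a : ℕ)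
    (F : (ℕ → (Fin n → ℤ)) → (ℕ → V) → V) :
    altL 𝕂 n V a F = (a.factorial : 𝕂)⁻¹ • ∑ σ : Equiv.Perm (Fin a), pact a σ F := by
  funext x X
  simp only [altL, LinearMap.coe_mk, AddHom.coe_mk, alt, Pi.smul_apply, Finset.sum_apply, pact,
    Int.cast_smul_eq_zsmul]

lemma altL_tsw {𝕂 : Type} [Field 𝕂] {n : ℕ} {V : Type} [AddCommGroup V] [Module 𝕂 V] (a k : ℕ)
    (hk : k + 1 < a) (F : (ℕ → (Fin n → ℤ)) → (ℕ → V) → V) :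
    altL 𝕂 n V a (tsw k F) = altL 𝕂 n V a F := by
  rw [altL_eq, altL_eq]
  congr 1
  have hk0 : k < a := by omega
  rw [← Equiv.sum_comp (Equiv.mulRight (Equiv.swap (⟨k, hk0⟩ : Fin a) ⟨k + 1, hk⟩))
    (fun σ => pact a σ F)]
  refine Finset.sum_congr rfl fun σ _ => ?_
  rw [Equiv.coe_mulRight, pact_mul_swap a σ ⟨k, hk0⟩ ⟨k + 1, hk⟩ rfl]

/-- A linear functional invariant under adjacent transpositions is invariant under the
alternator. -/
lemma inv_altL {𝕂 : Type} [Field 𝕂] [CharZero 𝕂] {n : ℕ} {V : Type} [AddCommGroup V]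
    [Module 𝕂 V] (a : ℕ)
    (Φ : ((ℕ → (Fin n → ℤ)) → (ℕ → V) → V) →ₗ[𝕂] ((ℕ → (Fin n → ℤ)) → (ℕ → V) → V))
    (hΦ : ∀ k F, k + 1 < a → Φ (tsw k F) = Φ F) (F : (ℕ → (Fin n → ℤ)) → (ℕ → V) → V) :
    Φ (altL 𝕂 n V a F) = Φ F := by
  have key : ∀ σ : Equiv.Perm (Fin a), ∀ F, Φ (pact a σ F) = Φ F := by
    rcases a with _ | m
    · intro σ F
      rw [Subsingleton.elim σ 1, pact_one]
    · intro σ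
      have hσ : σ ∈ Submonoid.closure
          (Set.range fun i : Fin m => Equiv.swap i.castSucc i.succ) := by
        rw [Equiv.Perm.mclosure_swap_castSucc_succ]; trivial
      induction hσ using Submonoid.closure_induction_right with
      | one => intro F; rw [pact_one]
      | mul_right τ _ s hs ih =>
        obtain ⟨i, rfl⟩ := hs
        intro F
        rw [pact_mul_swap (m + 1) τ i.castSucc i.succ (by simp), ih]
        exact hΦ _ _ (by simp)
  rw [altL_eq, map_smul, map_sum, Finset.sum_congr rfl (fun σ _ => key σ F), Finset.sum_const,
    Finset.card_univ, Fintype.card_perm, Fintype.card_fin, ← Nat.cast_smul_eq_nsmul 𝕂, smul_smul,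
    inv_mul_cancel₀ (Nat.cast_ne_zero.mpr a.factorial_ne_zero), one_smul]


/-! ### The insertion operation -/

/-- The `i`-th term of `jop`. -/
def jterm {n : ℕ} {V : Type} (a₁ : ℕ) (κ₁ κ₂ : Fin n → ℤ) (i : ℕ) [AddCommGroup V]
    (K₁ K₂ : (ℕ → (Fin n → ℤ)) → (ℕ → V) → V) : (ℕ → (Fin n → ℤ)) → (ℕ → V) → V :=
  fun x X => sgn (((a₁ : ℤ) - 1) * (i : ℤ) + pairZ n κ₁ (κ₂ + ∑ l ∈ Finset.range i, x l)) •
      K₂ (insSeq a₁ i ((∑ m ∈ Finset.range a₁, x (m + i)) + κ₁) x)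
         (insSeq a₁ i (K₁ (shiftSeq x i) (shiftSeq X i)) X)

lemma jop_eq_sum {n : ℕ} {V : Type} [AddCommGroup V] (a₁ a₂ : ℕ) (κ₁ κ₂ : Fin n → ℤ)
    (K₁ K₂ : (ℕ → (Fin n → ℤ)) → (ℕ → V) → V) :
    jop (pairZ n) a₁ κ₁ a₂ κ₂ K₁ K₂ = ∑ i ∈ Finset.range a₂, jterm a₁ κ₁ κ₂ i K₁ K₂ := by
  funext x X
  simp only [Finset.sum_apply]
  rfl

lemma insSeq_update {β : Type*} (a i : ℕ) (c d : β) (f : ℕ → β) :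
    insSeq a i c f = Function.update (insSeq a i d f) i c := by
  funext l
  unfold insSeq
  by_cases h : l = i
  · subst h; simp
  · rw [Function.update_of_ne h]; simp [h]

/-- `IsML` in the slot `i`: additivity and homogeneity for inserted values. -/
lemma IsML.ins_add {𝕂 : Type} [Field 𝕂] {G : Type} {V : Type} [AddCommGroup V] [Module 𝕂 V]
    {b : ℕ} {K : (ℕ → G) → (ℕ → V) → V} (h : IsML 𝕂 b K) (a i : ℕ) (hi : i < b)
    (y : ℕ → G) (X : ℕ → V) (u v : V) :
    K y (insSeq a i (u + v) X) = K y (insSeq a i u X) + K y (insSeq a i v X) := by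
  rw [insSeq_update a i (u + v) 0, insSeq_update a i u 0, insSeq_update a i v 0]
  exact (h.2.2 y _ i hi).1 u v

lemma IsML.ins_smul {𝕂 : Type} [Field 𝕂] {G : Type} {V : Type} [AddCommGroup V] [Module 𝕂 V]
    {b : ℕ} {K : (ℕ → G) → (ℕ → V) → V} (h : IsML 𝕂 b K) (a i : ℕ) (hi : i < b)
    (y : ℕ → G) (X : ℕ → V) (r : 𝕂) (u : V) :
    K y (insSeq a i (r • u) X) = r • K y (insSeq a i u X) := by
  rw [insSeq_update a i (r • u) 0, insSeq_update a i u 0]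
  exact (h.2.2 y _ i hi).2 r u

/-- The inserted value as a linear map. -/
def insL {𝕂 : Type} [Field 𝕂] {G : Type} {V : Type} [AddCommGroup V] [Module 𝕂 V]
    {b : ℕ} {K : (ℕ → G) → (ℕ → V) → V} (h : IsML 𝕂 b K) (a i : ℕ) (hi : i < b)
    (y : ℕ → G) (X : ℕ → V) : V →ₗ[𝕂] V where
  toFun u := K y (insSeq a i u X)
  map_add' := h.ins_add a i hi y X
  map_smul' := h.ins_smul a i hi y X

lemma IsML.ins_zsmul {𝕂 : Type} [Field 𝕂] {G : Type} {V : Type} [AddCommGroup V] [Module 𝕂 V]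
    {b : ℕ} {K : (ℕ → G) → (ℕ → V) → V} (h : IsML 𝕂 b K) (a i : ℕ) (hi : i < b)
    (y : ℕ → G) (X : ℕ → V) (r : ℤ) (u : V) :
    K y (insSeq a i (r • u) X) = r • K y (insSeq a i u X) :=
  map_zsmul (insL h a i hi y X) r u

lemma IsML.ins_sum {𝕂 : Type} [Field 𝕂] {G : Type} {V : Type} [AddCommGroup V] [Module 𝕂 V]
    {b : ℕ} {K : (ℕ → G) → (ℕ → V) → V} (h : IsML 𝕂 b K) (a i : ℕ) (hi : i < b)
    (y : ℕ → G) (X : ℕ → V) (s : Finset ℕ) (f : ℕ → V) :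
    K y (insSeq a i (∑ t ∈ s, f t) X) = ∑ t ∈ s, K y (insSeq a i (f t) X) :=
  map_sum (insL h a i hi y X) f s

/-- `jop` is linear in the first (inserted) cochain. -/
def jopL₁ {𝕂 : Type} [Field 𝕂] {n : ℕ} {V : Type} [AddCommGroup V] [Module 𝕂 V]
    (a₁ a₂ : ℕ) (κ₁ κ₂ : Fin n → ℤ) {K₂ : (ℕ → (Fin n → ℤ)) → (ℕ → V) → V}
    (h : IsML 𝕂 a₂ K₂) :
    ((ℕ → (Fin n → ℤ)) → (ℕ → V) → V) →ₗ[𝕂] ((ℕ → (Fin n → ℤ)) → (ℕ → V) → V) where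
  toFun F := jop (pairZ n) a₁ κ₁ a₂ κ₂ F K₂
  map_add' F F' := by
    funext x X
    simp only [jop, Pi.add_apply]
    rw [← Finset.sum_add_distrib]
    refine Finset.sum_congr rfl fun i hi => ?_
    rw [h.ins_add _ _ (Finset.mem_range.mp hi), smul_add]
  map_smul' r F := by
    funext x X
    simp only [jop, Pi.smul_apply, RingHom.id_apply]
    rw [Finset.smul_sum]
    refine Finset.sum_congr rfl fun i hi => ?_
    rw [h.ins_smul _ _ (Finset.mem_range.mp hi), smul_comm]

/-- `jop` is linear in the second cochain. -/
def jopL₂ {𝕂 : Type} [Field 𝕂] {n : ℕ} {V : Type} [AddCommGroup V] [Module 𝕂 V]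
    (a₁ a₂ : ℕ) (κ₁ κ₂ : Fin n → ℤ) (K₁ : (ℕ → (Fin n → ℤ)) → (ℕ → V) → V) :
    ((ℕ → (Fin n → ℤ)) → (ℕ → V) → V) →ₗ[𝕂] ((ℕ → (Fin n → ℤ)) → (ℕ → V) → V) where
  toFun F := jop (pairZ n) a₁ κ₁ a₂ κ₂ K₁ F
  map_add' F F' := by
    funext x X
    simp only [jop, Pi.add_apply]
    rw [← Finset.sum_add_distrib]
    refine Finset.sum_congr rfl fun i hi => ?_
    rw [smul_add]
  map_smul' r F := by
    funext x X
    simp only [jop, Pi.smul_apply, RingHom.id_apply]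
    rw [Finset.smul_sum]
    refine Finset.sum_congr rfl fun i hi => ?_
    rw [smul_comm]

lemma sum_swap_lt {M : Type*} [AddCommMonoid M] (f : ℕ → M) (k a : ℕ)
    (h : k + 1 < a ∨ a ≤ k) :
    ∑ l ∈ Finset.range a, f (Equiv.swap k (k + 1) l) = ∑ l ∈ Finset.range a, f l := by
  refine Finset.sum_bij' (fun l _ => Equiv.swap k (k + 1) l) (fun l _ => Equiv.swap k (k + 1) l)
    ?_ ?_ ?_ ?_ ?_
  · intro l hl
    rw [Finset.mem_range] at *
    rw [Equiv.swap_apply_def]; split_ifs <;> omega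
  · intro l hl
    rw [Finset.mem_range] at *
    rw [Equiv.swap_apply_def]; split_ifs <;> omega
  · intro l _; simp
  · intro l _; simp
  · intro l _; simp

lemma swap_add_right (k i m : ℕ) :
    Equiv.swap (k + i) (k + i + 1) (m + i) = Equiv.swap k (k + 1) m + i := by
  rw [Equiv.swap_apply_def, Equiv.swap_apply_def]
  split_ifs <;> omega

/-- Transposing inside the inserted cochain. -/
lemma jterm_tsw_left {𝕂 : Type} [Field 𝕂] {n : ℕ} {V : Type} [AddCommGroup V] [Module 𝕂 V]
    (a₁ a₂ : ℕ) (κ₁ κ₂ : Fin n → ℤ) {K₂ : (ℕ → (Fin n → ℤ)) → (ℕ → V) → V}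
    (h : IsML 𝕂 a₂ K₂) (F : (ℕ → (Fin n → ℤ)) → (ℕ → V) → V) (i k : ℕ) (hi : i < a₂)
    (hk : k + 1 < a₁) :
    jterm a₁ κ₁ κ₂ i (tsw k F) K₂ = tsw (k + i) (jterm a₁ κ₁ κ₂ i F K₂) := by
  funext x X
  unfold tsw jterm
  rw [h.ins_zsmul _ _ hi]
  have hins : ∀ {β : Type} (c : β) (f : ℕ → β),
      insSeq a₁ i c (fun l => f (Equiv.swap (k + i) (k + i + 1) l)) = insSeq a₁ i c f := by
    intro β c f
    funext l
    unfold insSeq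
    split_ifs with h1 h2
    · refine congrArg f ?_; rw [Equiv.swap_apply_def]; split_ifs <;> omega
    · rfl
    · refine congrArg f ?_; rw [Equiv.swap_apply_def]; split_ifs <;> omega
  have hsh : ∀ {β : Type} (f : ℕ → β),
      shiftSeq (fun l => f (Equiv.swap (k + i) (k + i + 1) l)) i
        = fun l => shiftSeq f i (Equiv.swap k (k + 1) l) := by
    intro β f
    funext l
    unfold shiftSeq
    simp only [swap_add_right]
  rw [hins, hins, hsh, hsh, sum_swap_lt x (k + i) i (Or.inr (by omega))]
  simp only [swap_add_right]
  rw [sum_swap_lt (fun m => x (m + i)) k a₁ (Or.inl hk)]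
  have e : k + 1 + i = k + i + 1 := by omega
  simp only [shiftSeq, e]
  rw [smul_comm]

lemma alt_jop_left {𝕂 : Type} [Field 𝕂] [CharZero 𝕂] {n : ℕ} {V : Type} [AddCommGroup V]
    [Module 𝕂 V]
    (a₁ a₂ : ℕ) (κ₁ κ₂ : Fin n → ℤ) {K₂ : (ℕ → (Fin n → ℤ)) → (ℕ → V) → V}
    (h : IsML 𝕂 a₂ K₂) (F : (ℕ → (Fin n → ℤ)) → (ℕ → V) → V) :
    altL 𝕂 n V (a₁ + a₂ - 1) (jop (pairZ n) a₁ κ₁ a₂ κ₂ (altL 𝕂 n V a₁ F) K₂)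
      = altL 𝕂 n V (a₁ + a₂ - 1) (jop (pairZ n) a₁ κ₁ a₂ κ₂ F K₂) := by
  refine inv_altL a₁ ((altL 𝕂 n V (a₁ + a₂ - 1)) ∘ₗ (jopL₁ a₁ a₂ κ₁ κ₂ h)) ?_ F
  intro k F hk
  change altL 𝕂 n V (a₁ + a₂ - 1) (jop (pairZ n) a₁ κ₁ a₂ κ₂ (tsw k F) K₂)
      = altL 𝕂 n V (a₁ + a₂ - 1) (jop (pairZ n) a₁ κ₁ a₂ κ₂ F K₂)
  rw [jop_eq_sum, jop_eq_sum, map_sum, map_sum]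
  refine Finset.sum_congr rfl fun i hi => ?_
  rw [Finset.mem_range] at hi
  rw [jterm_tsw_left a₁ a₂ κ₁ κ₂ h F i k hi hk, altL_tsw _ _ (by omega)]


/-- `IsML` cochains only depend on the first arguments. -/
lemma IsML.loc {𝕂 : Type} [Field 𝕂] {G : Type} {V : Type} [AddCommGroup V] [Module 𝕂 V]
    {b : ℕ} {K : (ℕ → G) → (ℕ → V) → V} (h : IsML 𝕂 b K) (x x' : ℕ → G) (X X' : ℕ → V)
    (hX : ∀ i, i < b → X i = X' i) : K x X = K x' X' := by
  rw [h.1 x x' X]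
  have hres := h.2.1 x' X X' hX
  exact hres

/-- Move the entry `k + m` in front of the block `k, …, k+m-1`. -/
def mvSeq {β : Type*} (k m : ℕ) (f : ℕ → β) : ℕ → β :=
  fun l => if l < k then f l else if l = k then f (k + m) else
    if l ≤ k + m then f (l - 1) else f l

/-- Graded-alternating action of the block move. -/
def bmv {n : ℕ} {V : Type} [AddCommGroup V] (k m : ℕ)
    (F : (ℕ → (Fin n → ℤ)) → (ℕ → V) → V) : (ℕ → (Fin n → ℤ)) → (ℕ → V) → V :=
  fun x X => sgn ((m : ℤ) + pairZ n (∑ t ∈ Finset.range m, x (t + k)) (x (k + m))) •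
    F (mvSeq k m x) (mvSeq k m X)

lemma bmv_zero {n : ℕ} {V : Type} [AddCommGroup V] (k : ℕ)
    (F : (ℕ → (Fin n → ℤ)) → (ℕ → V) → V) : bmv k 0 F = F := by
  funext x X
  have h : ∀ {β : Type} (f : ℕ → β), mvSeq k 0 f = f := by
    intro β f; funext l; unfold mvSeq
    split_ifs with h1 h2 h3
    · rfl
    · rw [h2, add_zero]
    · omega
    · rfl
  unfold bmv
  rw [h, h]
  simp [pairZ_zero_left, sgn_zero]

lemma bmv_succ {n : ℕ} {V : Type} [AddCommGroup V] (k m : ℕ)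
    (F : (ℕ → (Fin n → ℤ)) → (ℕ → V) → V) : bmv k (m + 1) F = tsw (k + m) (bmv k m F) := by
  funext x X
  have h : ∀ {β : Type} (f : ℕ → β), mvSeq k (m + 1) f
      = mvSeq k m (fun l => f (Equiv.swap (k + m) (k + m + 1) l)) := by
    intro β f; funext l; unfold mvSeq
    simp only [Equiv.swap_apply_def]
    split_ifs <;> first | rfl | omega | (congr 1; omega)
  unfold bmv tsw
  rw [h, h, smul_smul]
  congr 1
  have hs : ∑ t ∈ Finset.range m, x (Equiv.swap (k + m) (k + m + 1) (t + k))
      = ∑ t ∈ Finset.range m, x (t + k) := by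
    refine Finset.sum_congr rfl fun t ht => congrArg x ?_
    rw [Finset.mem_range] at ht
    rw [Equiv.swap_apply_def]; split_ifs <;> omega
  beta_reduce
  rw [hs, Equiv.swap_apply_left, Finset.sum_range_succ, pairZ_add_left, neg_sgn, ← sgn_add,
    add_comm m k, ← add_assoc]
  generalize (∑ t ∈ Finset.range m, x (t + k)) = S
  refine sgn_congr 0 ?_
  push_cast
  ring

lemma altL_bmv {𝕂 : Type} [Field 𝕂] {n : ℕ} {V : Type} [AddCommGroup V] [Module 𝕂 V]
    (a k m : ℕ) (hk : k + m < a) (F : (ℕ → (Fin n → ℤ)) → (ℕ → V) → V) :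
    altL 𝕂 n V a (bmv k m F) = altL 𝕂 n V a F := by
  induction m with
  | zero => rw [bmv_zero]
  | succ m ih => rw [bmv_succ, altL_tsw _ _ (by omega), ih (by omega)]

lemma jterm_tsw_lt {𝕂 : Type} [Field 𝕂] {n : ℕ} {V : Type} [AddCommGroup V] [Module 𝕂 V]
    (a₁ : ℕ) (κ₁ κ₂ : Fin n → ℤ) {K₁ : (ℕ → (Fin n → ℤ)) → (ℕ → V) → V}
    (h : IsML 𝕂 a₁ K₁) (F : (ℕ → (Fin n → ℤ)) → (ℕ → V) → V) (i k : ℕ) (hi : i < k) :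
    jterm a₁ κ₁ κ₂ i K₁ (tsw k F) = tsw (k + a₁ - 1) (jterm a₁ κ₁ κ₂ i K₁ F) := by
  funext x X
  unfold tsw jterm
  have hins : ∀ {β : Type} (c : β) (f : ℕ → β),
      insSeq a₁ i c (fun l => f (Equiv.swap (k + a₁ - 1) (k + a₁ - 1 + 1) l))
        = fun l => insSeq a₁ i c f (Equiv.swap k (k + 1) l) := by
    intro β c f
    funext l
    unfold insSeq
    simp only [Equiv.swap_apply_def]
    split_ifs <;> first | rfl | omega | (congr 1; omega)
  have hK : K₁ (shiftSeq (fun l => x (Equiv.swap (k + a₁ - 1) (k + a₁ - 1 + 1) l)) i)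
      (shiftSeq (fun l => X (Equiv.swap (k + a₁ - 1) (k + a₁ - 1 + 1) l)) i)
      = K₁ (shiftSeq x i) (shiftSeq X i) := by
    refine h.loc _ _ _ _ fun t ht => ?_
    unfold shiftSeq
    refine congrArg X ?_
    rw [Equiv.swap_apply_def]; split_ifs <;> omega
  have hs : ∑ m ∈ Finset.range a₁, x (Equiv.swap (k + a₁ - 1) (k + a₁ - 1 + 1) (m + i))
      = ∑ m ∈ Finset.range a₁, x (m + i) := by
    refine Finset.sum_congr rfl fun t ht => congrArg x ?_
    rw [Finset.mem_range] at ht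
    rw [Equiv.swap_apply_def]; split_ifs <;> omega
  rw [hK, hs, hins, hins, sum_swap_lt x _ i (Or.inr (by omega)), smul_comm]
  congr 4
  · unfold insSeq
    rw [if_neg (by omega), if_neg (by omega)]
  · unfold insSeq
    rw [if_neg (by omega), if_neg (by omega)]
    congr 1; omega

lemma jterm_tsw_gt {n : ℕ} {V : Type} [AddCommGroup V]
    (a₁ : ℕ) (κ₁ κ₂ : Fin n → ℤ) (K₁ : (ℕ → (Fin n → ℤ)) → (ℕ → V) → V)
    (F : (ℕ → (Fin n → ℤ)) → (ℕ → V) → V) (i k : ℕ) (hi : k + 1 < i) :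
    jterm a₁ κ₁ κ₂ i K₁ (tsw k F) = tsw k (jterm a₁ κ₁ κ₂ i K₁ F) := by
  funext x X
  unfold tsw jterm
  have hins : ∀ {β : Type} (c : β) (f : ℕ → β),
      insSeq a₁ i c (fun l => f (Equiv.swap k (k + 1) l))
        = fun l => insSeq a₁ i c f (Equiv.swap k (k + 1) l) := by
    intro β c f
    funext l
    unfold insSeq
    simp only [Equiv.swap_apply_def]
    split_ifs <;> first | rfl | omega | (congr 1; omega)
  have hsh : ∀ {β : Type} (f : ℕ → β),
      shiftSeq (fun l => f (Equiv.swap k (k + 1) l)) i = shiftSeq f i := by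
    intro β f
    funext l
    unfold shiftSeq
    refine congrArg f ?_
    rw [Equiv.swap_apply_def]; split_ifs <;> omega
  have hs : ∑ m ∈ Finset.range a₁, x (Equiv.swap k (k + 1) (m + i))
      = ∑ m ∈ Finset.range a₁, x (m + i) := by
    refine Finset.sum_congr rfl fun t ht => congrArg x ?_
    rw [Equiv.swap_apply_def]; split_ifs <;> omega
  rw [hsh, hsh, hs, hins, hins, sum_swap_lt x _ i (Or.inl (by omega)), smul_comm]
  congr 4
  · unfold insSeq
    rw [if_pos (by omega)]
  · unfold insSeq
    rw [if_pos (by omega)]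

lemma jterm_tsw_eq {𝕂 : Type} [Field 𝕂] {n : ℕ} {V : Type} [AddCommGroup V] [Module 𝕂 V]
    (a₁ : ℕ) (κ₁ κ₂ : Fin n → ℤ) {K₁ : (ℕ → (Fin n → ℤ)) → (ℕ → V) → V}
    (h : IsML 𝕂 a₁ K₁) (F : (ℕ → (Fin n → ℤ)) → (ℕ → V) → V) (k : ℕ) :
    jterm a₁ κ₁ κ₂ k K₁ (tsw k F) = bmv k a₁ (jterm a₁ κ₁ κ₂ (k + 1) K₁ F) := by
  funext x X
  unfold tsw jterm bmv
  have hins : ∀ {β : Type} (c : β) (f : ℕ → β),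
      insSeq a₁ (k + 1) c (mvSeq k a₁ f)
        = fun l => insSeq a₁ k c f (Equiv.swap k (k + 1) l) := by
    intro β c f
    funext l
    unfold insSeq mvSeq
    simp only [Equiv.swap_apply_def]
    split_ifs <;> first | rfl | omega | (congr 1; omega)
  have hK : K₁ (shiftSeq (mvSeq k a₁ x) (k + 1)) (shiftSeq (mvSeq k a₁ X) (k + 1))
      = K₁ (shiftSeq x k) (shiftSeq X k) := by
    refine h.loc _ _ _ _ fun t ht => ?_
    unfold shiftSeq mvSeq
    rw [if_neg (by omega), if_neg (by omega), if_pos (by omega)]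
    congr 1
  have hs : ∑ m ∈ Finset.range a₁, mvSeq k a₁ x (m + (k + 1))
      = ∑ m ∈ Finset.range a₁, x (m + k) := by
    refine Finset.sum_congr rfl fun t ht => ?_
    rw [Finset.mem_range] at ht
    unfold mvSeq
    rw [if_neg (by omega), if_neg (by omega), if_pos (by omega)]
    congr 1
  have hs2 : ∑ l ∈ Finset.range (k + 1), mvSeq k a₁ x l
      = ∑ l ∈ Finset.range k, x l + x (k + a₁) := by
    rw [Finset.sum_range_succ]
    congr 1
    · refine Finset.sum_congr rfl fun t ht => ?_
      rw [Finset.mem_range] at ht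
      unfold mvSeq
      rw [if_pos ht]
    · unfold mvSeq
      rw [if_neg (by omega), if_pos rfl]
  have e1 : ∀ c, insSeq a₁ k c x k = c := by
    intro c; unfold insSeq; rw [if_neg (by omega), if_pos rfl]
  have e2 : ∀ c, insSeq a₁ k c x (k + 1) = x (k + a₁) := by
    intro c; unfold insSeq; rw [if_neg (by omega), if_neg (by omega)]; congr 1; omega
  beta_reduce
  rw [hK, hs, hs2, hins, hins, e1, e2, smul_smul, smul_smul]
  congr 1
  rw [neg_sgn, ← sgn_add, ← sgn_add]
  simp only [pairZ_add_left, pairZ_add_right]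
  refine sgn_congr (1 - (a₁ : ℤ)) ?_
  push_cast
  ring

lemma alt_jop_right {𝕂 : Type} [Field 𝕂] [CharZero 𝕂] {n : ℕ} {V : Type} [AddCommGroup V]
    [Module 𝕂 V]
    (a₁ a₂ : ℕ) (κ₁ κ₂ : Fin n → ℤ) {K₁ : (ℕ → (Fin n → ℤ)) → (ℕ → V) → V}
    (h : IsML 𝕂 a₁ K₁) (F : (ℕ → (Fin n → ℤ)) → (ℕ → V) → V) :
    altL 𝕂 n V (a₁ + a₂ - 1) (jop (pairZ n) a₁ κ₁ a₂ κ₂ K₁ (altL 𝕂 n V a₂ F))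
      = altL 𝕂 n V (a₁ + a₂ - 1) (jop (pairZ n) a₁ κ₁ a₂ κ₂ K₁ F) := by
  refine inv_altL a₂ ((altL 𝕂 n V (a₁ + a₂ - 1)) ∘ₗ (jopL₂ a₁ a₂ κ₁ κ₂ K₁)) ?_ F
  intro k F hk
  change altL 𝕂 n V (a₁ + a₂ - 1) (jop (pairZ n) a₁ κ₁ a₂ κ₂ K₁ (tsw k F))
      = altL 𝕂 n V (a₁ + a₂ - 1) (jop (pairZ n) a₁ κ₁ a₂ κ₂ K₁ F)
  have hA : ∀ F, altL 𝕂 n V (a₁ + a₂ - 1) (jterm a₁ κ₁ κ₂ k K₁ (tsw k F))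
      = altL 𝕂 n V (a₁ + a₂ - 1) (jterm a₁ κ₁ κ₂ (k + 1) K₁ F) := by
    intro F
    rw [jterm_tsw_eq a₁ κ₁ κ₂ h, altL_bmv _ _ _ (by omega)]
  have hB : altL 𝕂 n V (a₁ + a₂ - 1) (jterm a₁ κ₁ κ₂ (k + 1) K₁ (tsw k F))
      = altL 𝕂 n V (a₁ + a₂ - 1) (jterm a₁ κ₁ κ₂ k K₁ F) := by
    rw [← hA, tsw_tsw]
  rw [jop_eq_sum, jop_eq_sum, map_sum, map_sum]
  rw [← sum_swap_lt (fun i => altL 𝕂 n V (a₁ + a₂ - 1) (jterm a₁ κ₁ κ₂ i K₁ F)) k a₂ (Or.inl hk)]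
  refine Finset.sum_congr rfl fun i hi => ?_
  rw [Finset.mem_range] at hi
  rcases lt_trichotomy i k with hik | hik | hik
  · rw [Equiv.swap_apply_of_ne_of_ne (by omega) (by omega), jterm_tsw_lt a₁ κ₁ κ₂ h F i k hik,
      altL_tsw _ _ (by omega)]
  · subst hik
    rw [Equiv.swap_apply_left, hA]
  · by_cases hik' : i = k + 1
    · subst hik'
      rw [Equiv.swap_apply_right, hB]
    · rw [Equiv.swap_apply_of_ne_of_ne (by omega) (by omega),
        jterm_tsw_gt a₁ κ₁ κ₂ K₁ F i k (by omega), altL_tsw _ _ (by omega)]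


/-! ### The graded pre-Lie identity -/

lemma sum_insSeq {n : ℕ} (a i j : ℕ) (hij : i < j) (κ : Fin n → ℤ) (x : ℕ → (Fin n → ℤ)) :
    ∑ l ∈ Finset.range j, insSeq a i ((∑ m ∈ Finset.range a, x (m + i)) + κ) x l
      = (∑ l ∈ Finset.range (j + a - 1), x l) + κ := by
  induction j, hij using Nat.le_induction with
  | base =>
    have e : i.succ + a - 1 = i + a := by omega
    rw [e, Finset.sum_range_succ, Finset.sum_range_add]
    have e1 : ∀ c, insSeq a i c x i = c := by
      intro c; unfold insSeq; rw [if_neg (by omega), if_pos rfl]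
    rw [e1, add_assoc]
    congr 1
    · refine Finset.sum_congr rfl fun t ht => ?_
      rw [Finset.mem_range] at ht
      unfold insSeq
      rw [if_pos ht]
    · congr 1
      exact Finset.sum_congr rfl fun t _ => by rw [add_comm]
  | succ j hj ih =>
    have hj' : i < j := hj
    have e : j + 1 + a - 1 = (j + a - 1) + 1 := by omega
    rw [e, Finset.sum_range_succ, ih, Finset.sum_range_succ]
    have e1 : ∀ c, insSeq a i c x j = x (j + a - 1) := by
      intro c; unfold insSeq; rw [if_neg (by omega), if_neg (by omega)]
    rw [e1]
    abel

lemma sum_insSeq_le {n : ℕ} (a i j : ℕ) (hij : j ≤ i) (c : Fin n → ℤ) (x : ℕ → (Fin n → ℤ)) :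
    ∑ l ∈ Finset.range j, insSeq a i c x l = ∑ l ∈ Finset.range j, x l := by
  refine Finset.sum_congr rfl fun t ht => ?_
  rw [Finset.mem_range] at ht
  unfold insSeq
  rw [if_pos (by omega)]

lemma jterm_nest {𝕂 : Type} [Field 𝕂] {n : ℕ} {V : Type} [AddCommGroup V] [Module 𝕂 V]
    (a₁ a₂ a₃ : ℕ) (κ₁ κ₂ κ₃ : Fin n → ℤ) {K₁ K₂ K₃ : (ℕ → (Fin n → ℤ)) → (ℕ → V) → V}
    (h₁ : IsML 𝕂 a₁ K₁) (h₂ : IsML 𝕂 a₂ K₂) (h₃ : IsML 𝕂 a₃ K₃)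
    (i j : ℕ) (hi : i < a₂) (hj : j < a₃) (x : ℕ → (Fin n → ℤ)) (X : ℕ → V) :
    jterm a₁ κ₁ (κ₂ + κ₃) (j + i) K₁ (jterm a₂ κ₂ κ₃ j K₂ K₃) x X
      = jterm (a₁ + a₂ - 1) (κ₁ + κ₂) κ₃ j (jterm a₁ κ₁ κ₂ i K₁ K₂) K₃ x X := by
  unfold jterm
  rw [h₃.ins_zsmul _ _ hj, smul_smul, smul_smul]
  congr 1
  · rw [sum_insSeq_le a₁ (j + i) j (by omega), ← sgn_add, ← sgn_add, Finset.sum_range_add]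
    have e : ((a₁ + a₂ - 1 : ℕ) : ℤ) = a₁ + a₂ - 1 := by omega
    have e2 : ∑ l ∈ Finset.range i, shiftSeq x j l = ∑ l ∈ Finset.range i, x (j + l) :=
      Finset.sum_congr rfl fun t _ => by unfold shiftSeq; rw [add_comm]
    rw [e, e2]
    simp only [pairZ_add_left, pairZ_add_right]
    refine sgn_congr 0 ?_
    push_cast
    ring
  · refine h₃.loc _ _ _ _ fun l _ => ?_
    have e3 : K₁ (shiftSeq x (j + i)) (shiftSeq X (j + i))
        = K₁ (shiftSeq (shiftSeq x j) i) (shiftSeq (shiftSeq X j) i) := by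
      refine h₁.loc _ _ _ _ fun t _ => ?_
      unfold shiftSeq
      congr 1; omega
    rw [e3]
    generalize K₁ (shiftSeq (shiftSeq x j) i) (shiftSeq (shiftSeq X j) i) = v
    have e4 : ∀ y y', K₂ y (shiftSeq (insSeq a₁ (j + i) v X) j)
        = K₂ y' (insSeq a₁ i v (shiftSeq X j)) := by
      intro y y'
      refine h₂.loc _ _ _ _ fun t _ => ?_
      unfold shiftSeq insSeq
      split_ifs <;> first | rfl | omega | (congr 1; omega)
    rw [e4 _ (insSeq a₁ i (∑ m ∈ Finset.range a₁, shiftSeq x j (m + i) + κ₁) (shiftSeq x j))]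
    generalize K₂ _ _ = w
    unfold insSeq
    split_ifs <;> first | rfl | omega | (congr 1; omega)

lemma jterm_disj {𝕂 : Type} [Field 𝕂] {n : ℕ} {V : Type} [AddCommGroup V] [Module 𝕂 V]
    (a₁ a₂ a₃ : ℕ) (κ₁ κ₂ κ₃ : Fin n → ℤ) {K₁ K₂ K₃ : (ℕ → (Fin n → ℤ)) → (ℕ → V) → V}
    (h₁ : IsML 𝕂 a₁ K₁) (h₂ : IsML 𝕂 a₂ K₂) (h₃ : IsML 𝕂 a₃ K₃)
    (i j : ℕ) (hij : i < j) (x : ℕ → (Fin n → ℤ)) (X : ℕ → V) :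
    jterm a₁ κ₁ (κ₂ + κ₃) i K₁ (jterm a₂ κ₂ κ₃ j K₂ K₃) x X
      = sgn (((a₁ : ℤ) - 1) * ((a₂ : ℤ) - 1) + pairZ n κ₁ κ₂) •
        jterm a₂ κ₂ (κ₁ + κ₃) (j + a₁ - 1) K₂ (jterm a₁ κ₁ κ₃ i K₁ K₃) x X := by
  unfold jterm
  rw [smul_smul, smul_smul, smul_smul]
  congr 1
  · rw [sum_insSeq a₁ i j hij, sum_insSeq_le a₂ (j + a₁ - 1) i (by omega), ← sgn_add, ← sgn_add,
      ← sgn_add]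
    have e : ((j + a₁ - 1 : ℕ) : ℤ) = j + a₁ - 1 := by omega
    rw [e]
    simp only [pairZ_add_right]
    rw [pairZ_comm n κ₂ κ₁]
    refine sgn_congr (- ((a₁ : ℤ) - 1) * ((a₂ : ℤ) - 1)) ?_
    ring
  · refine h₃.loc _ _ _ _ fun l _ => ?_
    have e3 : ∀ y y' v, K₁ y (shiftSeq (insSeq a₂ (j + a₁ - 1) v X) i)
        = K₁ y' (shiftSeq X i) := by
      intro y y' v
      refine h₁.loc _ _ _ _ fun t _ => ?_
      unfold shiftSeq insSeq
      rw [if_pos (by omega)]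
    have e4 : ∀ y y' v, K₂ y (shiftSeq (insSeq a₁ i v X) j)
        = K₂ y' (shiftSeq X (j + a₁ - 1)) := by
      intro y y' v
      refine h₂.loc _ _ _ _ fun t _ => ?_
      unfold shiftSeq insSeq
      rw [if_neg (by omega), if_neg (by omega)]
      congr 1; omega
    rw [e3 _ (shiftSeq x i), e4 _ (shiftSeq x (j + a₁ - 1))]
    generalize K₁ _ _ = v
    generalize K₂ _ _ = w
    unfold insSeq
    split_ifs <;> first | rfl | omega | (congr 1; omega)

lemma sum_tri {M : Type*} [AddCommMonoid M] (A : ℕ) (g : ℕ → ℕ → M) :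
    ∑ j ∈ Finset.range A, ∑ t ∈ Finset.range (A - 1 - j), g j (j + 1 + t)
      = ∑ i ∈ Finset.range A, ∑ j ∈ Finset.range i, g j i := by
  rw [Finset.sum_sigma', Finset.sum_sigma']
  refine Finset.sum_bij' (fun p _ => ⟨p.1 + 1 + p.2, p.1⟩) (fun p _ => ⟨p.2, p.1 - 1 - p.2⟩)
    ?_ ?_ ?_ ?_ ?_
  · rintro ⟨j, t⟩ h
    simp only [Finset.mem_sigma, Finset.mem_range] at *
    omega
  · rintro ⟨j, t⟩ h
    simp only [Finset.mem_sigma, Finset.mem_range] at *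
    omega
  · rintro ⟨j, t⟩ h
    simp only [Finset.mem_sigma, Finset.mem_range] at *
    congr 1
    omega
  · rintro ⟨j, t⟩ h
    simp only [Finset.mem_sigma, Finset.mem_range] at *
    congr 1
    omega
  · rintro ⟨j, t⟩ h
    rfl

lemma jop_jop_right {n : ℕ} {V : Type} [AddCommGroup V]
    (a₁ a₂ a₃ : ℕ) (κ₁ κ₂ κ₃ : Fin n → ℤ) (K₁ K₂ K₃ : (ℕ → (Fin n → ℤ)) → (ℕ → V) → V)
    (x : ℕ → (Fin n → ℤ)) (X : ℕ → V) :
    jop (pairZ n) a₁ κ₁ (a₂ + a₃ - 1) (κ₂ + κ₃) K₁ (jop (pairZ n) a₂ κ₂ a₃ κ₃ K₂ K₃) x X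
      = ∑ j ∈ Finset.range a₃, ∑ i ∈ Finset.range (a₂ + a₃ - 1),
          jterm a₁ κ₁ (κ₂ + κ₃) i K₁ (jterm a₂ κ₂ κ₃ j K₂ K₃) x X := by
  rw [Finset.sum_comm, jop_eq_sum, Finset.sum_apply, Finset.sum_apply]
  refine Finset.sum_congr rfl fun i _ => ?_
  unfold jterm
  rw [← Finset.smul_sum]
  rfl

lemma jop_jop_left {𝕂 : Type} [Field 𝕂] {n : ℕ} {V : Type} [AddCommGroup V] [Module 𝕂 V]
    (a₁ a₂ a₃ : ℕ) (κ₁ κ₂ κ₃ : Fin n → ℤ) {K₁ K₂ K₃ : (ℕ → (Fin n → ℤ)) → (ℕ → V) → V}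
    (h₃ : IsML 𝕂 a₃ K₃) (x : ℕ → (Fin n → ℤ)) (X : ℕ → V) :
    jop (pairZ n) (a₁ + a₂ - 1) (κ₁ + κ₂) a₃ κ₃ (jop (pairZ n) a₁ κ₁ a₂ κ₂ K₁ K₂) K₃ x X
      = ∑ j ∈ Finset.range a₃, ∑ i ∈ Finset.range a₂,
          jterm (a₁ + a₂ - 1) (κ₁ + κ₂) κ₃ j (jterm a₁ κ₁ κ₂ i K₁ K₂) K₃ x X := by
  rw [jop_eq_sum, Finset.sum_apply, Finset.sum_apply]
  refine Finset.sum_congr rfl fun j hj => ?_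
  rw [Finset.mem_range] at hj
  unfold jterm
  rw [← Finset.smul_sum]
  congr 1
  exact h₃.ins_sum _ _ hj _ _ _ _

/-- Sum of the terms with the two insertions in different slots, the first one on the left. -/
def disj {n : ℕ} {V : Type} [AddCommGroup V]
    (a₁ a₂ a₃ : ℕ) (κ₁ κ₂ κ₃ : Fin n → ℤ) (K₁ K₂ K₃ : (ℕ → (Fin n → ℤ)) → (ℕ → V) → V)
    (x : ℕ → (Fin n → ℤ)) (X : ℕ → V) : V :=
  ∑ j ∈ Finset.range a₃, ∑ i ∈ Finset.range j,
    jterm a₁ κ₁ (κ₂ + κ₃) i K₁ (jterm a₂ κ₂ κ₃ j K₂ K₃) x X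

lemma assoc_eq {𝕂 : Type} [Field 𝕂] {n : ℕ} {V : Type} [AddCommGroup V] [Module 𝕂 V]
    (a₁ a₂ a₃ : ℕ) (κ₁ κ₂ κ₃ : Fin n → ℤ) {K₁ K₂ K₃ : (ℕ → (Fin n → ℤ)) → (ℕ → V) → V}
    (h₁ : IsML 𝕂 a₁ K₁) (h₂ : IsML 𝕂 a₂ K₂) (h₃ : IsML 𝕂 a₃ K₃)
    (x : ℕ → (Fin n → ℤ)) (X : ℕ → V) :
    jop (pairZ n) a₁ κ₁ (a₂ + a₃ - 1) (κ₂ + κ₃) K₁ (jop (pairZ n) a₂ κ₂ a₃ κ₃ K₂ K₃) x X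
      = jop (pairZ n) (a₁ + a₂ - 1) (κ₁ + κ₂) a₃ κ₃ (jop (pairZ n) a₁ κ₁ a₂ κ₂ K₁ K₂) K₃ x X
        + (disj a₁ a₂ a₃ κ₁ κ₂ κ₃ K₁ K₂ K₃ x X
          + sgn (((a₁ : ℤ) - 1) * ((a₂ : ℤ) - 1) + pairZ n κ₁ κ₂) •
            disj a₂ a₁ a₃ κ₂ κ₁ κ₃ K₂ K₁ K₃ x X) := by
  rw [jop_jop_right, jop_jop_left a₁ a₂ a₃ κ₁ κ₂ κ₃ h₃]
  unfold disj
  have hE : sgn (((a₁ : ℤ) - 1) * ((a₂ : ℤ) - 1) + pairZ n κ₁ κ₂) •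
      ∑ j ∈ Finset.range a₃, ∑ i ∈ Finset.range j,
        jterm a₂ κ₂ (κ₁ + κ₃) i K₂ (jterm a₁ κ₁ κ₃ j K₁ K₃) x X
      = ∑ j ∈ Finset.range a₃, ∑ t ∈ Finset.range (a₃ - 1 - j),
        jterm a₁ κ₁ (κ₂ + κ₃) (j + a₂ + t) K₁ (jterm a₂ κ₂ κ₃ j K₂ K₃) x X := by
    have e : ∀ j t, j + a₂ + t = (j + 1 + t) + a₂ - 1 := by intro j t; omega
    simp only [e]
    rw [sum_tri a₃ (fun j i => jterm a₁ κ₁ (κ₂ + κ₃) (i + a₂ - 1) K₁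
      (jterm a₂ κ₂ κ₃ j K₂ K₃) x X), Finset.smul_sum]
    refine Finset.sum_congr rfl fun j _ => ?_
    rw [Finset.smul_sum]
    refine Finset.sum_congr rfl fun i hi => ?_
    rw [Finset.mem_range] at hi
    rw [jterm_disj a₂ a₁ a₃ κ₂ κ₁ κ₃ h₂ h₁ h₃ i j hi, smul_smul, pairZ_comm n κ₂ κ₁,
      mul_comm ((a₂ : ℤ) - 1), sgn_mul_self, one_smul]
  rw [hE, ← Finset.sum_add_distrib, ← Finset.sum_add_distrib]
  refine Finset.sum_congr rfl fun j hj => ?_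
  rw [Finset.mem_range] at hj
  have e : a₂ + a₃ - 1 = (j + a₂) + (a₃ - 1 - j) := by omega
  rw [e, Finset.sum_range_add, Finset.sum_range_add]
  rw [Finset.sum_congr rfl (g := fun i => jterm (a₁ + a₂ - 1) (κ₁ + κ₂) κ₃ j
    (jterm a₁ κ₁ κ₂ i K₁ K₂) K₃ x X) (s₁ := Finset.range a₂)
    (fun i hi => jterm_nest a₁ a₂ a₃ κ₁ κ₂ κ₃ h₁ h₂ h₃ i j (Finset.mem_range.mp hi) hj x X)]
  abel

/-- The graded pre-Lie identity. -/
lemma prelie {𝕂 : Type} [Field 𝕂] {n : ℕ} {V : Type} [AddCommGroup V] [Module 𝕂 V]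
    (a₁ a₂ a₃ : ℕ) (κ₁ κ₂ κ₃ : Fin n → ℤ) {K₁ K₂ K₃ : (ℕ → (Fin n → ℤ)) → (ℕ → V) → V}
    (h₁ : IsML 𝕂 a₁ K₁) (h₂ : IsML 𝕂 a₂ K₂) (h₃ : IsML 𝕂 a₃ K₃) :
    jop (pairZ n) a₁ κ₁ (a₂ + a₃ - 1) (κ₂ + κ₃) K₁ (jop (pairZ n) a₂ κ₂ a₃ κ₃ K₂ K₃)
      - jop (pairZ n) (a₁ + a₂ - 1) (κ₁ + κ₂) a₃ κ₃ (jop (pairZ n) a₁ κ₁ a₂ κ₂ K₁ K₂) K₃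
      = sgn (((a₁ : ℤ) - 1) * ((a₂ : ℤ) - 1) + pairZ n κ₁ κ₂) •
        (jop (pairZ n) a₂ κ₂ (a₁ + a₃ - 1) (κ₁ + κ₃) K₂ (jop (pairZ n) a₁ κ₁ a₃ κ₃ K₁ K₃)
      - jop (pairZ n) (a₂ + a₁ - 1) (κ₂ + κ₁) a₃ κ₃ (jop (pairZ n) a₂ κ₂ a₁ κ₁ K₂ K₁) K₃) := by
  funext x X
  simp only [Pi.sub_apply, Pi.smul_apply]
  rw [assoc_eq a₁ a₂ a₃ κ₁ κ₂ κ₃ h₁ h₂ h₃, assoc_eq a₂ a₁ a₃ κ₂ κ₁ κ₃ h₂ h₁ h₃,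
    add_sub_cancel_left, add_sub_cancel_left, smul_add, smul_smul, pairZ_comm n κ₂ κ₁,
    mul_comm ((a₂ : ℤ) - 1), sgn_mul_self, one_smul, add_comm]


/-! ### Iterated brackets -/

/-- `j(K₁)(j(K₂)K₃)`. -/
def Xf {n : ℕ} {V : Type} [AddCommGroup V]
    (a₁ a₂ a₃ : ℕ) (κ₁ κ₂ κ₃ : Fin n → ℤ) (K₁ K₂ K₃ : (ℕ → (Fin n → ℤ)) → (ℕ → V) → V) :
    (ℕ → (Fin n → ℤ)) → (ℕ → V) → V :=
  jop (pairZ n) a₁ κ₁ (a₂ + a₃ - 1) (κ₂ + κ₃) K₁ (jop (pairZ n) a₂ κ₂ a₃ κ₃ K₂ K₃)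

/-- `j(j(K₁)K₂)K₃`. -/
def Yf {n : ℕ} {V : Type} [AddCommGroup V]
    (a₁ a₂ a₃ : ℕ) (κ₁ κ₂ κ₃ : Fin n → ℤ) (K₁ K₂ K₃ : (ℕ → (Fin n → ℤ)) → (ℕ → V) → V) :
    (ℕ → (Fin n → ℤ)) → (ℕ → V) → V :=
  jop (pairZ n) (a₁ + a₂ - 1) (κ₁ + κ₂) a₃ κ₃ (jop (pairZ n) a₁ κ₁ a₂ κ₂ K₁ K₂) K₃

/-- The sign of the bidegrees. -/
def S {n : ℕ} (a₁ a₂ : ℕ) (κ₁ κ₂ : Fin n → ℤ) : ℤ :=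
  sgn (((a₁ : ℤ) - 1) * ((a₂ : ℤ) - 1) + pairZ n κ₁ κ₂)

lemma S_comm {n : ℕ} (a₁ a₂ : ℕ) (κ₁ κ₂ : Fin n → ℤ) : S a₁ a₂ κ₁ κ₂ = S a₂ a₁ κ₂ κ₁ := by
  unfold S; rw [mul_comm, pairZ_comm]

lemma S_cases {n : ℕ} (a₁ a₂ : ℕ) (κ₁ κ₂ : Fin n → ℤ) :
    S a₁ a₂ κ₁ κ₂ = 1 ∨ S a₁ a₂ κ₁ κ₂ = -1 :=
  mul_self_eq_one_iff.mp (sgn_mul_self _)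

lemma S_add_right {n : ℕ} (a₁ a₂ a₃ : ℕ) (κ₁ κ₂ κ₃ : Fin n → ℤ) (h : a₂ + a₃ ≠ 0) :
    S a₁ (a₂ + a₃ - 1) κ₁ (κ₂ + κ₃) = S a₁ a₂ κ₁ κ₂ * S a₁ a₃ κ₁ κ₃ := by
  unfold S
  have e : ((a₂ + a₃ - 1 : ℕ) : ℤ) = a₂ + a₃ - 1 := by omega
  rw [e, ← sgn_add, pairZ_add_right]
  congr 1; ring

lemma jop_zero_arity {n : ℕ} {V : Type} [AddCommGroup V] (a₁ : ℕ)
    (κ₁ κ₂ : Fin n → ℤ) (K₁ K₂ : (ℕ → (Fin n → ℤ)) → (ℕ → V) → V) :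
    jop (pairZ n) a₁ κ₁ 0 κ₂ K₁ K₂ = 0 := by
  rw [jop_eq_sum]; simp

lemma Xf_zero {n : ℕ} {V : Type} [AddCommGroup V]
    (a₁ a₂ a₃ : ℕ) (κ₁ κ₂ κ₃ : Fin n → ℤ) (K₁ K₂ K₃ : (ℕ → (Fin n → ℤ)) → (ℕ → V) → V)
    (h : a₂ + a₃ = 0) : Xf a₁ a₂ a₃ κ₁ κ₂ κ₃ K₁ K₂ K₃ = 0 := by
  obtain ⟨rfl, rfl⟩ : a₂ = 0 ∧ a₃ = 0 := by omega
  exact jop_zero_arity _ _ _ _ _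

lemma Yf_zero {𝕂 : Type} [Field 𝕂] {n : ℕ} {V : Type} [AddCommGroup V] [Module 𝕂 V]
    (a₁ a₂ a₃ : ℕ) (κ₁ κ₂ κ₃ : Fin n → ℤ) (K₁ K₂ : (ℕ → (Fin n → ℤ)) → (ℕ → V) → V)
    {K₃ : (ℕ → (Fin n → ℤ)) → (ℕ → V) → V} (h₃ : IsML 𝕂 a₃ K₃)
    (h : a₁ + a₂ = 0) : Yf a₁ a₂ a₃ κ₁ κ₂ κ₃ K₁ K₂ K₃ = 0 := by
  obtain ⟨rfl, rfl⟩ : a₁ = 0 ∧ a₂ = 0 := by omega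
  unfold Yf
  rw [jop_zero_arity]
  exact map_zero (jopL₁ _ a₃ _ κ₃ h₃)

lemma iop_eq {𝕂 : Type} [Field 𝕂] {n : ℕ} {V : Type} [AddCommGroup V] [Module 𝕂 V]
    (a₁ a₂ : ℕ) (κ₁ κ₂ : Fin n → ℤ) (K₁ K₂ : (ℕ → (Fin n → ℤ)) → (ℕ → V) → V) :
    iop 𝕂 (pairZ n) a₁ κ₁ a₂ κ₂ K₁ K₂
      = (((a₁ + a₂ - 1).factorial : 𝕂) / ((a₁.factorial : 𝕂) * (a₂.factorial : 𝕂))) •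
        altL 𝕂 n V (a₁ + a₂ - 1) (jop (pairZ n) a₁ κ₁ a₂ κ₂ K₁ K₂) := rfl

lemma brW_eq {𝕂 : Type} [Field 𝕂] {n : ℕ} {V : Type} [AddCommGroup V] [Module 𝕂 V]
    (a₁ a₂ : ℕ) (κ₁ κ₂ : Fin n → ℤ) (K₁ K₂ : (ℕ → (Fin n → ℤ)) → (ℕ → V) → V) :
    brW 𝕂 (pairZ n) a₁ κ₁ a₂ κ₂ K₁ K₂
      = iop 𝕂 (pairZ n) a₁ κ₁ a₂ κ₂ K₁ K₂
        - S a₁ a₂ κ₁ κ₂ • iop 𝕂 (pairZ n) a₂ κ₂ a₁ κ₁ K₂ K₁ := rfl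

lemma iop_iop_right {𝕂 : Type} [Field 𝕂] [CharZero 𝕂] {n : ℕ} {V : Type} [AddCommGroup V]
    [Module 𝕂 V] (a₁ a₂ a₃ : ℕ) (κ₁ κ₂ κ₃ : Fin n → ℤ)
    {K₁ K₂ K₃ : (ℕ → (Fin n → ℤ)) → (ℕ → V) → V} (h₁ : IsML 𝕂 a₁ K₁) :
    iop 𝕂 (pairZ n) a₁ κ₁ (a₂ + a₃ - 1) (κ₂ + κ₃) K₁ (iop 𝕂 (pairZ n) a₂ κ₂ a₃ κ₃ K₂ K₃)
      = (((a₁ + a₂ + a₃ - 2).factorial : 𝕂) /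
          ((a₁.factorial : 𝕂) * (a₂.factorial : 𝕂) * (a₃.factorial : 𝕂))) •
        altL 𝕂 n V (a₁ + a₂ + a₃ - 2) (Xf a₁ a₂ a₃ κ₁ κ₂ κ₃ K₁ K₂ K₃) := by
  have hl : ∀ (r : 𝕂) F, jop (pairZ n) a₁ κ₁ (a₂ + a₃ - 1) (κ₂ + κ₃) K₁ (r • F)
      = r • jop (pairZ n) a₁ κ₁ (a₂ + a₃ - 1) (κ₂ + κ₃) K₁ F :=
    fun r F => map_smul (jopL₂ a₁ (a₂ + a₃ - 1) κ₁ (κ₂ + κ₃) K₁) r F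
  rw [iop_eq, iop_eq, hl, map_smul, alt_jop_right a₁ (a₂ + a₃ - 1) κ₁ (κ₂ + κ₃) h₁, smul_smul]
  change _ • altL 𝕂 n V _ (Xf a₁ a₂ a₃ κ₁ κ₂ κ₃ K₁ K₂ K₃) = _
  by_cases h : a₂ + a₃ = 0
  · rw [Xf_zero _ _ _ _ _ _ _ _ _ h, map_zero, map_zero, smul_zero, smul_zero]
  · have e : a₁ + (a₂ + a₃ - 1) - 1 = a₁ + a₂ + a₃ - 2 := by omega
    rw [e]
    congr 1
    have f0 := fun m : ℕ => (Nat.cast_ne_zero (R := 𝕂)).mpr m.factorial_ne_zero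
    have f1 := f0 a₁
    have f2 := f0 a₂
    have f3 := f0 a₃
    have f4 := f0 (a₂ + a₃ - 1)
    field_simp

lemma iop_iop_left {𝕂 : Type} [Field 𝕂] [CharZero 𝕂] {n : ℕ} {V : Type} [AddCommGroup V]
    [Module 𝕂 V] (a₁ a₂ a₃ : ℕ) (κ₁ κ₂ κ₃ : Fin n → ℤ)
    {K₁ K₂ K₃ : (ℕ → (Fin n → ℤ)) → (ℕ → V) → V} (h₃ : IsML 𝕂 a₃ K₃) :
    iop 𝕂 (pairZ n) (a₁ + a₂ - 1) (κ₁ + κ₂) a₃ κ₃ (iop 𝕂 (pairZ n) a₁ κ₁ a₂ κ₂ K₁ K₂) K₃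
      = (((a₁ + a₂ + a₃ - 2).factorial : 𝕂) /
          ((a₁.factorial : 𝕂) * (a₂.factorial : 𝕂) * (a₃.factorial : 𝕂))) •
        altL 𝕂 n V (a₁ + a₂ + a₃ - 2) (Yf a₁ a₂ a₃ κ₁ κ₂ κ₃ K₁ K₂ K₃) := by
  have hl : ∀ (r : 𝕂) F, jop (pairZ n) (a₁ + a₂ - 1) (κ₁ + κ₂) a₃ κ₃ (r • F) K₃
      = r • jop (pairZ n) (a₁ + a₂ - 1) (κ₁ + κ₂) a₃ κ₃ F K₃ :=
    fun r F => map_smul (jopL₁ (a₁ + a₂ - 1) a₃ (κ₁ + κ₂) κ₃ h₃) r F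
  rw [iop_eq, iop_eq, hl, map_smul, alt_jop_left (a₁ + a₂ - 1) a₃ (κ₁ + κ₂) κ₃ h₃, smul_smul]
  change _ • altL 𝕂 n V _ (Yf a₁ a₂ a₃ κ₁ κ₂ κ₃ K₁ K₂ K₃) = _
  by_cases h : a₁ + a₂ = 0
  · rw [Yf_zero _ _ _ _ _ _ _ _ h₃ h, map_zero, map_zero, smul_zero, smul_zero]
  · have e : a₁ + a₂ - 1 + a₃ - 1 = a₁ + a₂ + a₃ - 2 := by omega
    rw [e]
    congr 1
    have f0 := fun m : ℕ => (Nat.cast_ne_zero (R := 𝕂)).mpr m.factorial_ne_zero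
    have f1 := f0 a₁
    have f2 := f0 a₂
    have f3 := f0 a₃
    have f4 := f0 (a₁ + a₂ - 1)
    field_simp

lemma iop_sub_right {𝕂 : Type} [Field 𝕂] {n : ℕ} {V : Type} [AddCommGroup V] [Module 𝕂 V]
    (a₁ a₂ : ℕ) (κ₁ κ₂ : Fin n → ℤ) (K₁ F F' : (ℕ → (Fin n → ℤ)) → (ℕ → V) → V) (s : ℤ) :
    iop 𝕂 (pairZ n) a₁ κ₁ a₂ κ₂ K₁ (F - s • F')
      = iop 𝕂 (pairZ n) a₁ κ₁ a₂ κ₂ K₁ F - s • iop 𝕂 (pairZ n) a₁ κ₁ a₂ κ₂ K₁ F' := by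
  have hl : jop (pairZ n) a₁ κ₁ a₂ κ₂ K₁ (F - s • F')
      = jop (pairZ n) a₁ κ₁ a₂ κ₂ K₁ F - s • jop (pairZ n) a₁ κ₁ a₂ κ₂ K₁ F' := by
    have := map_sub (jopL₂ (𝕂 := 𝕂) a₁ a₂ κ₁ κ₂ K₁) F (s • F')
    rw [map_zsmul] at this
    exact this
  rw [iop_eq, iop_eq, iop_eq, hl, map_sub, map_zsmul, smul_sub, smul_comm s]

lemma iop_sub_left {𝕂 : Type} [Field 𝕂] {n : ℕ} {V : Type} [AddCommGroup V] [Module 𝕂 V]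
    (a₁ a₂ : ℕ) (κ₁ κ₂ : Fin n → ℤ) {K₂ : (ℕ → (Fin n → ℤ)) → (ℕ → V) → V}
    (h : IsML 𝕂 a₂ K₂) (F F' : (ℕ → (Fin n → ℤ)) → (ℕ → V) → V) (s : ℤ) :
    iop 𝕂 (pairZ n) a₁ κ₁ a₂ κ₂ (F - s • F') K₂
      = iop 𝕂 (pairZ n) a₁ κ₁ a₂ κ₂ F K₂ - s • iop 𝕂 (pairZ n) a₁ κ₁ a₂ κ₂ F' K₂ := by
  have hl : jop (pairZ n) a₁ κ₁ a₂ κ₂ (F - s • F') K₂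
      = jop (pairZ n) a₁ κ₁ a₂ κ₂ F K₂ - s • jop (pairZ n) a₁ κ₁ a₂ κ₂ F' K₂ := by
    have := map_sub (jopL₁ a₁ a₂ κ₁ κ₂ h) F (s • F')
    rw [map_zsmul] at this
    exact this
  rw [iop_eq, iop_eq, iop_eq, hl, map_sub, map_zsmul, smul_sub, smul_comm s]

/-- The normalization constant of double brackets. -/
def cst (𝕂 : Type) [Field 𝕂] (a₁ a₂ a₃ : ℕ) : 𝕂 :=
  ((a₁ + a₂ + a₃ - 2).factorial : 𝕂) /
          ((a₁.factorial : 𝕂) * (a₂.factorial : 𝕂) * (a₃.factorial : 𝕂))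

/-- The normalized alternator on double brackets. -/
def calt (𝕂 : Type) [Field 𝕂] (n : ℕ) (V : Type) [AddCommGroup V] [Module 𝕂 V]
    (a₁ a₂ a₃ : ℕ) :
    ((ℕ → (Fin n → ℤ)) → (ℕ → V) → V) →ₗ[𝕂] ((ℕ → (Fin n → ℤ)) → (ℕ → V) → V) :=
  cst 𝕂 a₁ a₂ a₃ • altL 𝕂 n V (a₁ + a₂ + a₃ - 2)

lemma calt_12 {𝕂 : Type} [Field 𝕂] {n : ℕ} {V : Type} [AddCommGroup V] [Module 𝕂 V]
    (a₁ a₂ a₃ : ℕ) : calt 𝕂 n V a₁ a₂ a₃ = calt 𝕂 n V a₂ a₁ a₃ := by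
  unfold calt cst
  rw [add_comm a₁ a₂, mul_comm (a₁.factorial : 𝕂)]

lemma calt_23 {𝕂 : Type} [Field 𝕂] {n : ℕ} {V : Type} [AddCommGroup V] [Module 𝕂 V]
    (a₁ a₂ a₃ : ℕ) : calt 𝕂 n V a₁ a₂ a₃ = calt 𝕂 n V a₁ a₃ a₂ := by
  unfold calt cst
  rw [add_right_comm, mul_right_comm]

lemma brW_brW_right {𝕂 : Type} [Field 𝕂] [CharZero 𝕂] {n : ℕ} {V : Type} [AddCommGroup V]
    [Module 𝕂 V] (a₁ a₂ a₃ : ℕ) (κ₁ κ₂ κ₃ : Fin n → ℤ)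
    {K₁ K₂ K₃ : (ℕ → (Fin n → ℤ)) → (ℕ → V) → V} (h₁ : IsML 𝕂 a₁ K₁) :
    brW 𝕂 (pairZ n) a₁ κ₁ (a₂ + a₃ - 1) (κ₂ + κ₃) K₁ (brW 𝕂 (pairZ n) a₂ κ₂ a₃ κ₃ K₂ K₃)
      = calt 𝕂 n V a₁ a₂ a₃
        (Xf a₁ a₂ a₃ κ₁ κ₂ κ₃ K₁ K₂ K₃ - S a₂ a₃ κ₂ κ₃ • Xf a₁ a₃ a₂ κ₁ κ₃ κ₂ K₁ K₃ K₂
          - (S a₁ a₂ κ₁ κ₂ * S a₁ a₃ κ₁ κ₃) •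
            (Yf a₂ a₃ a₁ κ₂ κ₃ κ₁ K₂ K₃ K₁ - S a₂ a₃ κ₂ κ₃ • Yf a₃ a₂ a₁ κ₃ κ₂ κ₁ K₃ K₂ K₁)) := by
  have A1 := iop_iop_right a₁ a₂ a₃ κ₁ κ₂ κ₃ (K₂ := K₂) (K₃ := K₃) h₁
  have A2 := iop_iop_right a₁ a₃ a₂ κ₁ κ₃ κ₂ (K₂ := K₃) (K₃ := K₂) h₁
  have B1 := iop_iop_left a₂ a₃ a₁ κ₂ κ₃ κ₁ (K₁ := K₂) (K₂ := K₃) h₁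
  have B2 := iop_iop_left a₃ a₂ a₁ κ₃ κ₂ κ₁ (K₁ := K₃) (K₂ := K₂) h₁
  change _ = calt 𝕂 n V a₁ a₂ a₃ _ at A1
  change _ = calt 𝕂 n V a₁ a₃ a₂ _ at A2
  change _ = calt 𝕂 n V a₂ a₃ a₁ _ at B1
  change _ = calt 𝕂 n V a₃ a₂ a₁ _ at B2
  rw [add_comm a₃ a₂, add_comm κ₃ κ₂] at A2 B2
  rw [calt_23 a₁ a₃ a₂] at A2
  rw [calt_23 a₂ a₃ a₁, calt_12 a₂ a₁ a₃] at B1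
  rw [calt_12 a₃ a₂ a₁, calt_23 a₂ a₃ a₁, calt_12 a₂ a₁ a₃] at B2
  rw [brW_eq, brW_eq a₂ a₃, iop_sub_right, iop_sub_left _ _ _ _ h₁, A1, A2, B1, B2]
  by_cases h : a₂ + a₃ = 0
  · rw [Yf_zero a₂ a₃ a₁ κ₂ κ₃ κ₁ K₂ K₃ h₁ h, Yf_zero a₃ a₂ a₁ κ₃ κ₂ κ₁ K₃ K₂ h₁ (by omega)]
    simp only [map_zero, smul_zero, sub_zero, map_sub, map_zsmul]
  · rw [S_add_right _ _ _ _ _ _ h]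
    simp only [map_sub, map_zsmul]

lemma brW_anti {𝕂 : Type} [Field 𝕂] {n : ℕ} {V : Type} [AddCommGroup V] [Module 𝕂 V]
    (b c : ℕ) (β γ : Fin n → ℤ) (F F' : (ℕ → (Fin n → ℤ)) → (ℕ → V) → V) :
    brW 𝕂 (pairZ n) b β c γ F F' = - (S b c β γ • brW 𝕂 (pairZ n) c γ b β F' F) := by
  rw [brW_eq, brW_eq, S_comm c b]
  rcases S_cases b c β γ with h | h <;> rw [h] <;> simp

lemma brW_brW_left {𝕂 : Type} [Field 𝕂] [CharZero 𝕂] {n : ℕ} {V : Type} [AddCommGroup V]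
    [Module 𝕂 V] (a₁ a₂ a₃ : ℕ) (κ₁ κ₂ κ₃ : Fin n → ℤ)
    {K₁ K₂ K₃ : (ℕ → (Fin n → ℤ)) → (ℕ → V) → V} (h₃ : IsML 𝕂 a₃ K₃) :
    brW 𝕂 (pairZ n) (a₁ + a₂ - 1) (κ₁ + κ₂) a₃ κ₃ (brW 𝕂 (pairZ n) a₁ κ₁ a₂ κ₂ K₁ K₂) K₃
      = calt 𝕂 n V a₁ a₂ a₃
        (Yf a₁ a₂ a₃ κ₁ κ₂ κ₃ K₁ K₂ K₃ - S a₁ a₂ κ₁ κ₂ • Yf a₂ a₁ a₃ κ₂ κ₁ κ₃ K₂ K₁ K₃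
          - (S a₁ a₃ κ₁ κ₃ * S a₂ a₃ κ₂ κ₃) •
            (Xf a₃ a₁ a₂ κ₃ κ₁ κ₂ K₃ K₁ K₂ - S a₁ a₂ κ₁ κ₂ • Xf a₃ a₂ a₁ κ₃ κ₂ κ₁ K₃ K₂ K₁)) := by
  have hS := brW_brW_right a₃ a₁ a₂ κ₃ κ₁ κ₂ (K₂ := K₁) (K₃ := K₂) h₃
  rw [brW_anti, hS, calt_12 a₃ a₁ a₂, calt_23 a₁ a₃ a₂]
  by_cases h : a₁ + a₂ = 0
  · rw [Xf_zero _ _ _ _ _ _ _ _ _ h, Xf_zero _ _ _ _ _ _ _ _ _ (show a₂ + a₁ = 0 by omega),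
      Yf_zero _ _ _ _ _ _ _ _ h₃ h, Yf_zero _ _ _ _ _ _ _ _ h₃ (show a₂ + a₁ = 0 by omega)]
    simp
  · rw [S_comm (a₁ + a₂ - 1) a₃, S_add_right _ _ _ _ _ _ h, S_comm a₃ a₁, S_comm a₃ a₂,
      ← map_zsmul, ← map_neg]
    congr 1
    rcases S_cases a₁ a₂ κ₁ κ₂ with h12 | h12 <;> rcases S_cases a₁ a₃ κ₁ κ₃ with h13 | h13 <;>
      rcases S_cases a₂ a₃ κ₂ κ₃ with h23 | h23 <;> rw [h12, h13, h23] <;>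
      simp only [one_smul, neg_smul, mul_one, one_mul, mul_neg, neg_neg] <;> abel


lemma jacobi {𝕂 : Type} [Field 𝕂] [CharZero 𝕂] {n : ℕ} {V : Type} [AddCommGroup V]
    [Module 𝕂 V] (a₁ a₂ a₃ : ℕ) (κ₁ κ₂ κ₃ : Fin n → ℤ)
    {K₁ K₂ K₃ : (ℕ → (Fin n → ℤ)) → (ℕ → V) → V}
    (h₁ : IsML 𝕂 a₁ K₁) (h₂ : IsML 𝕂 a₂ K₂) (h₃ : IsML 𝕂 a₃ K₃) :
    brW 𝕂 (pairZ n) a₁ κ₁ (a₂ + a₃ - 1) (κ₂ + κ₃) K₁ (brW 𝕂 (pairZ n) a₂ κ₂ a₃ κ₃ K₂ K₃)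
      = brW 𝕂 (pairZ n) (a₁ + a₂ - 1) (κ₁ + κ₂) a₃ κ₃ (brW 𝕂 (pairZ n) a₁ κ₁ a₂ κ₂ K₁ K₂) K₃
        + S a₁ a₂ κ₁ κ₂ • brW 𝕂 (pairZ n) a₂ κ₂ (a₁ + a₃ - 1) (κ₁ + κ₃) K₂
            (brW 𝕂 (pairZ n) a₁ κ₁ a₃ κ₃ K₁ K₃) := by
  rw [brW_brW_right a₁ a₂ a₃ κ₁ κ₂ κ₃ h₁, brW_brW_left a₁ a₂ a₃ κ₁ κ₂ κ₃ h₃,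
    brW_brW_right a₂ a₁ a₃ κ₂ κ₁ κ₃ h₂, calt_12 a₂ a₁ a₃, S_comm a₂ a₁, ← map_zsmul, ← map_add]
  congr 1
  have P1 := prelie a₁ a₂ a₃ κ₁ κ₂ κ₃ h₁ h₂ h₃
  have P2 := prelie a₁ a₃ a₂ κ₁ κ₃ κ₂ h₁ h₃ h₂
  have P3 := prelie a₂ a₃ a₁ κ₂ κ₃ κ₁ h₂ h₃ h₁
  change Xf a₁ a₂ a₃ κ₁ κ₂ κ₃ K₁ K₂ K₃ - Yf a₁ a₂ a₃ κ₁ κ₂ κ₃ K₁ K₂ K₃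
    = S a₁ a₂ κ₁ κ₂ • (Xf a₂ a₁ a₃ κ₂ κ₁ κ₃ K₂ K₁ K₃ - Yf a₂ a₁ a₃ κ₂ κ₁ κ₃ K₂ K₁ K₃) at P1
  change Xf a₁ a₃ a₂ κ₁ κ₃ κ₂ K₁ K₃ K₂ - Yf a₁ a₃ a₂ κ₁ κ₃ κ₂ K₁ K₃ K₂
    = S a₁ a₃ κ₁ κ₃ • (Xf a₃ a₁ a₂ κ₃ κ₁ κ₂ K₃ K₁ K₂ - Yf a₃ a₁ a₂ κ₃ κ₁ κ₂ K₃ K₁ K₂) at P2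
  change Xf a₂ a₃ a₁ κ₂ κ₃ κ₁ K₂ K₃ K₁ - Yf a₂ a₃ a₁ κ₂ κ₃ κ₁ K₂ K₃ K₁
    = S a₂ a₃ κ₂ κ₃ • (Xf a₃ a₂ a₁ κ₃ κ₂ κ₁ K₃ K₂ K₁ - Yf a₃ a₂ a₁ κ₃ κ₂ κ₁ K₃ K₂ K₁) at P3
  rw [sub_eq_iff_eq_add] at P1 P2 P3
  rw [P1, P2, P3]
  rcases S_cases a₁ a₂ κ₁ κ₂ with h12 | h12 <;> rcases S_cases a₁ a₃ κ₁ κ₃ with h13 | h13 <;>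
    rcases S_cases a₂ a₃ κ₂ κ₃ with h23 | h23 <;> rw [h12, h13, h23] <;>
    simp only [one_smul, neg_smul, mul_one, one_mul, mul_neg, neg_neg] <;> abel

lemma jop_mem {𝕂 : Type} [Field 𝕂] {n : ℕ} {V : Type} [AddCommGroup V] [Module 𝕂 V]
    (gr : (Fin n → ℤ) → Submodule 𝕂 V) (a₁ a₂ : ℕ) (κ₁ κ₂ : Fin n → ℤ)
    {K₁ K₂ : (ℕ → (Fin n → ℤ)) → (ℕ → V) → V}
    (h₁ : MDeg 𝕂 gr a₁ κ₁ K₁) (h₂ : MDeg 𝕂 gr a₂ κ₂ K₂)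
    (x : ℕ → (Fin n → ℤ)) (X : ℕ → V) (hX : ∀ i, X i ∈ gr (x i)) :
    jop (pairZ n) a₁ κ₁ a₂ κ₂ K₁ K₂ x X
      ∈ gr ((∑ i ∈ Finset.range (a₁ + a₂ - 1), x i) + (κ₁ + κ₂)) := by
  unfold jop
  refine Submodule.sum_mem _ fun i hi => zsmul_mem ?_ _
  rw [Finset.mem_range] at hi
  have hm := h₂.2 (insSeq a₁ i ((∑ m ∈ Finset.range a₁, x (m + i)) + κ₁) x)
    (insSeq a₁ i (K₁ (shiftSeq x i) (shiftSeq X i)) X) ?_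
  · rw [sum_insSeq a₁ i a₂ hi, add_assoc, add_comm a₂ a₁] at hm
    exact hm
  · intro l
    unfold insSeq
    split_ifs
    · exact hX l
    · exact h₁.2 (shiftSeq x i) (shiftSeq X i) fun m => hX (m + i)
    · exact hX _

lemma iop_mem {𝕂 : Type} [Field 𝕂] {n : ℕ} {V : Type} [AddCommGroup V] [Module 𝕂 V]
    (gr : (Fin n → ℤ) → Submodule 𝕂 V) (a₁ a₂ : ℕ) (κ₁ κ₂ : Fin n → ℤ)
    {K₁ K₂ : (ℕ → (Fin n → ℤ)) → (ℕ → V) → V}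
    (h₁ : MDeg 𝕂 gr a₁ κ₁ K₁) (h₂ : MDeg 𝕂 gr a₂ κ₂ K₂)
    (x : ℕ → (Fin n → ℤ)) (X : ℕ → V) (hX : ∀ i, X i ∈ gr (x i)) :
    iop 𝕂 (pairZ n) a₁ κ₁ a₂ κ₂ K₁ K₂ x X
      ∈ gr ((∑ i ∈ Finset.range (a₁ + a₂ - 1), x i) + (κ₁ + κ₂)) := by
  unfold iop alt
  refine Submodule.smul_mem _ _ (Submodule.smul_mem _ _
    (Submodule.sum_mem _ fun σ _ => Submodule.smul_mem _ _ ?_))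
  have hm := jop_mem gr a₁ a₂ κ₁ κ₂ h₁ h₂ (permSeq _ σ x) (permSeq _ σ X) ?_
  · have e : ∑ i ∈ Finset.range (a₁ + a₂ - 1), permSeq (a₁ + a₂ - 1) σ x i
        = ∑ i ∈ Finset.range (a₁ + a₂ - 1), x i := by
      rw [Finset.sum_range, Finset.sum_range, ← Equiv.sum_comp σ (fun i => x (i : ℕ))]
      refine Finset.sum_congr rfl fun i _ => ?_
      unfold permSeq
      rw [dif_pos i.2]
    rw [e] at hm
    exact hm
  · intro l
    unfold permSeq
    split_ifs
    · exact hX _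
    · exact hX _


/-- `(A(V), [·,·]^∧)` (the multigraded Nijenhuis–Richardson algebra,
`A(V) = α(M(V))`) is an `(n+1)`-graded Lie algebra: the bracket of homogeneous elements of
bidegrees `(k₁,κ₁)`, `(k₂,κ₂)` is homogeneous of bidegree `(k₁+k₂,κ₁+κ₂)`, it is
`(n+1)`-graded anticommutative and satisfies the `(n+1)`-graded Jacobi identity
(on homogeneous arguments; arities `aᵢ = kᵢ+1`). -/
theorem stmt9 {𝕂 : Type} [Field 𝕂] [CharZero 𝕂] (n : ℕ)
    {V : Type} [AddCommGroup V] [Module 𝕂 V]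
    (gr : (Fin n → ℤ) → Submodule 𝕂 V) (hgr : DirectSum.IsInternal gr)
    (a₁ a₂ a₃ : ℕ) (κ₁ κ₂ κ₃ : Fin n → ℤ)
    (K₁ K₂ K₃ : (ℕ → (Fin n → ℤ)) → (ℕ → V) → V)
    (h₁ : ADeg 𝕂 (pairZ n) gr a₁ κ₁ K₁) (h₂ : ADeg 𝕂 (pairZ n) gr a₂ κ₂ K₂)
    (h₃ : ADeg 𝕂 (pairZ n) gr a₃ κ₃ K₃) :
    (∀ x X, (∀ i, X i ∈ gr (x i)) →
        brW 𝕂 (pairZ n) a₁ κ₁ a₂ κ₂ K₁ K₂ x X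
          ∈ gr ((∑ i ∈ Finset.range (a₁ + a₂ - 1), x i) + (κ₁ + κ₂))) ∧
    (∀ x X, (∀ i, X i ∈ gr (x i)) →
        brW 𝕂 (pairZ n) a₁ κ₁ a₂ κ₂ K₁ K₂ x X
          = - (sgn (((a₁ : ℤ) - 1) * ((a₂ : ℤ) - 1) + pairZ n κ₁ κ₂) •
              brW 𝕂 (pairZ n) a₂ κ₂ a₁ κ₁ K₂ K₁ x X)) ∧
    (∀ x X, (∀ i, X i ∈ gr (x i)) →
        brW 𝕂 (pairZ n) a₁ κ₁ (a₂ + a₃ - 1) (κ₂ + κ₃) K₁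
            (brW 𝕂 (pairZ n) a₂ κ₂ a₃ κ₃ K₂ K₃) x X
          = brW 𝕂 (pairZ n) (a₁ + a₂ - 1) (κ₁ + κ₂) a₃ κ₃
              (brW 𝕂 (pairZ n) a₁ κ₁ a₂ κ₂ K₁ K₂) K₃ x X
            + sgn (((a₁ : ℤ) - 1) * ((a₂ : ℤ) - 1) + pairZ n κ₁ κ₂) •
              brW 𝕂 (pairZ n) a₂ κ₂ (a₁ + a₃ - 1) (κ₁ + κ₃) K₂
                (brW 𝕂 (pairZ n) a₁ κ₁ a₃ κ₃ K₁ K₃) x X) := by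
  refine ⟨fun x X hX => ?_, fun x X _ => ?_, fun x X _ => ?_⟩
  · have m1 := iop_mem gr a₁ a₂ κ₁ κ₂ h₁.1 h₂.1 x X hX
    have m2 := iop_mem gr a₂ a₁ κ₂ κ₁ h₂.1 h₁.1 x X hX
    rw [add_comm a₂ a₁, add_comm κ₂ κ₁] at m2
    exact sub_mem m1 (zsmul_mem m2 _)
  · exact congrFun (congrFun (brW_anti a₁ a₂ κ₁ κ₂ K₁ K₂) x) X
  · exact congrFun (congrFun (jacobi a₁ a₂ a₃ κ₁ κ₂ κ₃ h₁.1.1 h₂.1.1 h₃.1.1) x) X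


end NR
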